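/- Let σ be a distortion function. Then |·|*_{σ,∞} is a norm on L*_{σ,∞}(P) turning it into a Banach space, and the map Φ : (L*_{σ,∞}(P), |·|*_{σ,∞}) → (L_σ^1(P)*, ‖·‖*), Φ(Z)(Y) := E(ZY), is an isometric isomorphism onto the continuous dual of L_σ^1(P). -/

import Mathlib

open MeasureTheory
open scoped ENNReal NNReal

noncomputable section

variable {Ω : Type*} [MeasurableSpace Ω]

/-- A `[0,1]`-valued random variable uniformly distributed on `[0,1]`:
`P(U ≤ u) = u` for all `u ∈ [0,1]`. -/
def IsUniformRV (P : Measure Ω) (U : Ω → ℝ) : Prop :=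
  Measurable U ∧ (∀ ω, U ω ∈ Set.Icc (0 : ℝ) 1) ∧
    ∀ u ∈ Set.Icc (0 : ℝ) 1, P {ω | U ω ≤ u} = ENNReal.ofReal u

/-- A distortion function: nondecreasing, nonnegative, left-continuous on `[0,1)`
with `∫₀¹ σ(u) du = 1`. -/
structure IsDistortion (σ : ℝ → ℝ) : Prop where
  nonneg : ∀ u ∈ Set.Ico (0 : ℝ) 1, 0 ≤ σ u
  mono : MonotoneOn σ (Set.Ico (0 : ℝ) 1)
  left_continuous : ∀ u ∈ Set.Ioo (0 : ℝ) 1,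
    Filter.Tendsto σ (nhdsWithin u (Set.Iio u)) (nhds (σ u))
  integral_one : ∫ u in Set.Ioo (0 : ℝ) 1, σ u = 1

/-- `‖Y‖_{σ,p}^p := sup over uniform U of E[σ(U)·‖Y‖^p]`. -/
def sigmaPow (P : Measure Ω) (σ : ℝ → ℝ) (p : ℝ) {X : Type*} [NormedAddCommGroup X]
    (Y : Ω → X) : ℝ≥0∞ :=
  ⨆ (U : Ω → ℝ) (_ : IsUniformRV P U),
    ∫⁻ ω, ENNReal.ofReal (σ (U ω)) * (‖Y ω‖₊ : ℝ≥0∞) ^ p ∂P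

/-- The norm `‖Y‖_{σ,p}`. -/
def sigmaNorm (P : Measure Ω) (σ : ℝ → ℝ) (p : ℝ) {X : Type*} [NormedAddCommGroup X]
    (Y : Ω → X) : ℝ≥0∞ :=
  sigmaPow P σ p Y ^ (1 / p)

/-- Membership in `L_σ^p(P,X)`: strongly measurable with finite `σ,p`-norm. -/
def MemLsigma (P : Measure Ω) (σ : ℝ → ℝ) (p : ℝ) {X : Type*} [NormedAddCommGroup X]
    (Y : Ω → X) : Prop :=
  AEStronglyMeasurable Y P ∧ sigmaPow P σ p Y < ∞

/-- The generalized inverse distribution function (quantile function)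
`F_g^{-1}(α) = inf {q : P(g ≤ q) ≥ α}`. -/
def quantileFn (P : Measure Ω) (g : Ω → ℝ) (α : ℝ) : ℝ :=
  sInf {q : ℝ | ENNReal.ofReal α ≤ P {ω | g ω ≤ q}}

variable {𝕂 : Type*} [RCLike 𝕂]

/-- The Köthe dual of `L_σ^p(P)`:
`{Z measurable : Z·Y ∈ L¹(P) for all Y ∈ L_σ^p(P)}`. -/
def KoetheDual (P : Measure Ω) (σ : ℝ → ℝ) (p : ℝ) (Z : Ω → 𝕂) : Prop :=
  AEStronglyMeasurable Z P ∧
    ∀ Y : Ω → 𝕂, MemLsigma P σ p Y → Integrable (fun ω => Z ω * Y ω) P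

/-- The average value-at-risk of level `α` of the (nonnegative) random variable `g`:
`AV@R_α(g) = (1/(1−α)) ∫_α^1 F_g^{-1}(u) du`. -/
def avar (P : Measure Ω) (g : Ω → ℝ) (α : ℝ) : ℝ≥0∞ :=
  ENNReal.ofReal (1 / (1 - α)) *
    ∫⁻ u in Set.Ioo α 1, ENNReal.ofReal (quantileFn P g u)

/-- `Z'` σ-dominates `Z`: there is a uniform `U` with
`AV@R_α(σ(U)·|Z'|) ≥ AV@R_α(|Z|)` for all `α < 1`. -/
def SigmaDominates (P : Measure Ω) (σ : ℝ → ℝ) (Z' Z : Ω → 𝕂) : Prop :=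
  ∃ U : Ω → ℝ, IsUniformRV P U ∧ ∀ α ∈ Set.Ico (0 : ℝ) 1,
    avar P (fun ω => ‖Z ω‖) α ≤ avar P (fun ω => σ (U ω) * ‖Z' ω‖) α

/-- `|Z|*_{σ,∞} = sup_{α ∈ [0,1)} AV@R_α(|Z|) / ((1/(1−α))·S_σ(α))
 = sup_{α ∈ [0,1)} (∫_α^1 F_{|Z|}^{-1}(u) du) / (∫_α^1 σ(u) du)`. -/
def dualNormInf (P : Measure Ω) (σ : ℝ → ℝ) (Z : Ω → 𝕂) : ℝ≥0∞ :=
  ⨆ (α : ℝ) (_ : α ∈ Set.Ico (0 : ℝ) 1),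
    (∫⁻ u in Set.Ioo α 1, ENNReal.ofReal (quantileFn P (fun ω => ‖Z ω‖) u)) /
      ENNReal.ofReal (∫ u in Set.Ioo α 1, σ u)

/-- `|Z|*_{σ,q} = inf {‖Z'‖_{σ,q} : Z' σ-dominates Z}` (with `inf ∅ = ∞`). -/
def dualNormQ (P : Measure Ω) (σ : ℝ → ℝ) (q : ℝ) (Z : Ω → 𝕂) : ℝ≥0∞ :=
  ⨅ (Z' : Ω → 𝕂) (_ : AEStronglyMeasurable Z' P ∧ SigmaDominates P σ Z' Z),
    sigmaNorm P σ q Z'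

section DualityProof

open Set Filter Topology ProbabilityTheory

section UniformRepresentation

variable {P : Measure Ω} [IsProbabilityMeasure P]

lemma IsUniformRV.measure_gt {U : Ω → ℝ} (hU : IsUniformRV P U) {u : ℝ}
    (hu : u ∈ Icc (0 : ℝ) 1) : P {ω | u < U ω} = ENNReal.ofReal (1 - u) := by
  have h : {ω | u < U ω} = {ω | U ω ≤ u}ᶜ := by ext; simp
  rw [h, prob_compl_eq_one_sub (measurableSet_le hU.1 measurable_const), hU.2.2 u hu,
    ENNReal.ofReal_sub _ hu.1, ENNReal.ofReal_one]

lemma IsUniformRV.map_eq {U : Ω → ℝ} (hU : IsUniformRV P U) :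
    P.map U = volume.restrict (Ioo (0 : ℝ) 1) := by
  have := Measure.isProbabilityMeasure_map (μ := P) hU.1.aemeasurable
  refine Measure.ext_of_Iic _ _ fun u => ?_
  rw [Measure.map_apply hU.1 measurableSet_Iic, restrict_Ioo_eq_restrict_Ioc,
    Measure.restrict_apply measurableSet_Iic, inter_comm, Ioc_inter_Iic, Real.volume_Ioc, sub_zero]
  rcases lt_or_ge u 0 with h0 | h0
  · have : U ⁻¹' Iic u = ∅ := by
      ext ω
      simpa using h0.trans_le (hU.2.1 ω).1
    rw [this, measure_empty, ENNReal.ofReal_of_nonpos (min_le_of_right_le h0.le)]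
  rcases le_total u 1 with h1 | h1
  · rw [min_eq_right h1]
    exact hU.2.2 u ⟨h0, h1⟩
  · have : U ⁻¹' Iic u = univ := by
      ext ω
      simpa using (hU.2.1 ω).2.trans h1
    rw [this, min_eq_left h1, measure_univ, ENNReal.ofReal_one]

lemma continuous_cdf (μ : Measure ℝ) [IsProbabilityMeasure μ] [NullSingletonClass μ] :
    Continuous (cdf μ) := by
  refine continuous_iff_continuousAt.2 fun x => ?_
  rw [(monotone_cdf μ).continuousAt_iff_leftLim_eq_rightLim, (cdf μ).rightLim_eq]
  refine le_antisymm ((monotone_cdf μ).leftLim_le le_rfl) ?_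
  have h := (cdf μ).measure_singleton x
  rw [measure_cdf, measure_singleton, eq_comm, ENNReal.ofReal_eq_zero] at h
  linarith

/-- The probability integral transform. -/
lemma measure_cdf_le (μ : Measure ℝ) [IsProbabilityMeasure μ] [NullSingletonClass μ] {u : ℝ}
    (hu : u ∈ Icc (0 : ℝ) 1) : μ {x | cdf μ x ≤ u} = ENNReal.ofReal u := by
  have key : ∀ u : ℝ, 0 < u → u < 1 → μ {x | cdf μ x ≤ u} = ENNReal.ofReal u := by
    intro u h0 h1
    obtain ⟨a, ha⟩ := ((tendsto_cdf_atBot μ).eventually (gt_mem_nhds h0)).exists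
    obtain ⟨b, hb⟩ := ((tendsto_cdf_atTop μ).eventually (lt_mem_nhds h1)).exists
    obtain ⟨x₀, hx₀⟩ := mem_range_of_exists_le_of_exists_ge (continuous_cdf μ) ⟨a, ha.le⟩
      ⟨b, hb.le⟩
    have hbdd : BddAbove {x | cdf μ x ≤ u} := ⟨b, fun x hx => by
      by_contra! h
      exact absurd (hb.trans_le (monotone_cdf μ h.le)) (not_lt.2 hx)⟩
    have hcl : IsClosed {x | cdf μ x ≤ u} := isClosed_le (continuous_cdf μ) continuous_const
    have hmem := hcl.csSup_mem ⟨x₀, hx₀.le⟩ hbdd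
    have heq : {x | cdf μ x ≤ u} = Iic (sSup {x | cdf μ x ≤ u}) := by
      ext x
      exact ⟨fun hx => le_csSup hbdd hx, fun hx => (monotone_cdf μ hx).trans hmem⟩
    rw [heq, ← ofReal_cdf]
    congr 1
    exact le_antisymm hmem (hx₀.symm.le.trans (monotone_cdf μ (le_csSup hbdd hx₀.le)))
  rcases eq_or_lt_of_le hu.2 with rfl | h1
  · simp [cdf_le_one]
  rcases eq_or_lt_of_le hu.1 with rfl | h0
  · rw [ENNReal.ofReal_zero, ← nonpos_iff_eq_zero]
    have hlim : Tendsto (fun v : ℝ => ENNReal.ofReal v) (𝓝[>] 0) (𝓝 0) := by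
      have : Tendsto (fun v : ℝ => ENNReal.ofReal v) (𝓝 0) (𝓝 (ENNReal.ofReal 0)) :=
        ENNReal.continuous_ofReal.tendsto 0
      simpa using this.mono_left nhdsWithin_le_nhds
    refine ge_of_tendsto hlim ?_
    filter_upwards [Ioo_mem_nhdsGT (zero_lt_one' ℝ)] with v hv
    rw [← key v hv.1 hv.2]
    exact measure_mono fun x (hx : cdf μ x ≤ 0) => hx.trans hv.1.le
  · exact key u h0 h1

/-- A version of `f` with continuous distribution, strictly increasing in `f`. -/
def atomSplit (P : Measure Ω) (f V : Ω → ℝ) (ω : Ω) : ℝ :=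
  f ω + P.real {ω' | f ω' < f ω} + P.real {ω' | f ω' = f ω} * V ω

lemma atomSplit_lt {f V : Ω → ℝ} (hf : Measurable f) (hV : ∀ ω, V ω ∈ Icc (0 : ℝ) 1)
    {ω₁ ω₂ : Ω} (h : f ω₁ < f ω₂) : atomSplit P f V ω₁ < atomSplit P f V ω₂ := by
  have h1 : P.real {ω' | f ω' < f ω₁} + P.real {ω' | f ω' = f ω₁} ≤ P.real {ω' | f ω' < f ω₂} := by
    rw [← measureReal_union _ (measurableSet_eq_fun hf measurable_const)]
    · refine measureReal_mono ?_
      rintro ω (h' | h')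
      · exact lt_trans h' h
      · exact lt_of_eq_of_lt h' h
    · exact Set.disjoint_left.2 fun ω h1 h2 => ne_of_lt h1 h2
  have h2 : P.real {ω' | f ω' = f ω₁} * V ω₁ ≤ P.real {ω' | f ω' = f ω₁} :=
    mul_le_of_le_one_right measureReal_nonneg (hV ω₁).2
  have h3 : 0 ≤ P.real {ω' | f ω' = f ω₂} * V ω₂ := mul_nonneg measureReal_nonneg (hV ω₂).1
  unfold atomSplit
  linarith

lemma measurable_atomSplit {f V : Ω → ℝ} (hf : Measurable f) (hV : Measurable V) :
    Measurable (atomSplit P f V) := by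
  have h1 : Measurable fun y : ℝ => P.real {ω' | f ω' < y} :=
    Monotone.measurable fun a b hab => measureReal_mono fun ω (h : f ω < a) => h.trans_le hab
  have h2 : Measurable fun y : ℝ => P.real {ω' | f ω' ≤ y} :=
    Monotone.measurable fun a b hab => measureReal_mono fun ω (h : f ω ≤ a) => h.trans hab
  have h3 : ∀ y : ℝ, P.real {ω' | f ω' = y} = P.real {ω' | f ω' ≤ y} - P.real {ω' | f ω' < y} := by
    intro y
    rw [← measureReal_sdiff (s₁ := {ω' | f ω' ≤ y}) (s₂ := {ω' | f ω' < y})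
      (fun ω (h : f ω < y) => h.le) (measurableSet_lt hf measurable_const)]
    congr 1
    ext ω
    simp [le_antisymm_iff]
  unfold atomSplit
  simp only [h3]
  exact (hf.add (h1.comp hf)).add (((h2.comp hf).sub (h1.comp hf)).mul hV)

lemma measure_eq_of_uniform {V : Ω → ℝ} (hV : IsUniformRV P V) (c : ℝ) :
    P {ω | V ω = c} = 0 := by
  have : P (V ⁻¹' {c}) = 0 := by
    rw [← Measure.map_apply hV.1 (measurableSet_singleton c), hV.map_eq]
    exact measure_singleton c
  exact this

lemma noAtoms_map_atomSplit {f V : Ω → ℝ} (hf : Measurable f) (hV : IsUniformRV P V) :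
    NullSingletonClass (P.map (atomSplit P f V)) := by
  refine ⟨fun c => ?_⟩
  rw [Measure.map_apply (measurable_atomSplit hf hV.1) (measurableSet_singleton c)]
  rcases (atomSplit P f V ⁻¹' {c}).eq_empty_or_nonempty with h | ⟨ω₀, h₀⟩
  · rw [h, measure_empty]
  have hsub : ∀ ω ∈ atomSplit P f V ⁻¹' {c}, f ω = f ω₀ := by
    intro ω hω
    by_contra hne
    have e : atomSplit P f V ω = atomSplit P f V ω₀ := Eq.trans hω (Eq.symm h₀)
    rcases lt_or_gt_of_ne hne with hlt | hlt
    · exact (atomSplit_lt (P := P) hf hV.2.1 hlt).ne e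
    · exact (atomSplit_lt (P := P) hf hV.2.1 hlt).ne e.symm
  by_cases hp : P.real {ω | f ω = f ω₀} = 0
  · exact measure_mono_null (t := {ω | f ω = f ω₀}) hsub ((measureReal_eq_zero_iff).1 hp)
  · refine measure_mono_null (t := {ω | V ω = V ω₀}) ?_ (measure_eq_of_uniform hV _)
    intro ω hω
    have e : atomSplit P f V ω = atomSplit P f V ω₀ := Eq.trans hω (Eq.symm h₀)
    unfold atomSplit at e
    rw [hsub ω hω] at e
    exact mul_left_cancel₀ hp (by linarith)

/-- Every random variable is comonotone with some uniform random variable. -/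
lemma exists_comonotone_uniform (hrich : ∃ V : Ω → ℝ, IsUniformRV P V) {f : Ω → ℝ}
    (hf : Measurable f) : ∃ U : Ω → ℝ, IsUniformRV P U ∧
      ∀ t, {ω | P.real {ω' | f ω' ≤ t} < U ω} =ᵐ[P] {ω | t < f ω} := by
  obtain ⟨V, hV⟩ := hrich
  set g := atomSplit P f V with hg
  have hgm : Measurable g := measurable_atomSplit hf hV.1
  have hna : NullSingletonClass (P.map g) := noAtoms_map_atomSplit hf hV
  have := Measure.isProbabilityMeasure_map (μ := P) hgm.aemeasurable
  have hcm : Measurable (cdf (P.map g)) := (monotone_cdf _).measurable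
  have hU : IsUniformRV P fun ω => cdf (P.map g) (g ω) := by
    refine ⟨hcm.comp hgm, fun ω => ⟨cdf_nonneg _ _, cdf_le_one _ _⟩, fun u hu => ?_⟩
    rw [← measure_cdf_le (P.map g) hu,
      Measure.map_apply hgm (measurableSet_le hcm measurable_const)]
    rfl
  refine ⟨_, hU, fun t => ?_⟩
  refine ae_eq_of_subset_of_measure_ge ?_ ?_ ?_ (measure_ne_top _ _)
  · intro ω hω
    by_contra hlt
    simp only [mem_ofPred_eq, not_lt] at hlt hω
    refine absurd hω (not_lt.2 ?_)
    rw [cdf_eq_real, map_measureReal_apply hgm measurableSet_Iic]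
    refine measureReal_mono fun ω' (h' : g ω' ≤ g ω) => ?_
    by_contra! hc
    simp only [mem_ofPred_eq, not_le] at hc
    exact absurd (atomSplit_lt (P := P) hf hV.2.1 (hlt.trans_lt hc)) (not_lt.2 h')
  · rw [hU.measure_gt ⟨measureReal_nonneg, measureReal_le_one⟩]
    have : {ω | t < f ω} = {ω | f ω ≤ t}ᶜ := by ext; simp
    rw [this, ← ofReal_measureReal,
      probReal_compl_eq_one_sub (measurableSet_le hf measurable_const)]
  · exact (measurableSet_lt measurable_const hU.1).nullMeasurableSet

end UniformRepresentation

section TailWeight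

/-- The mass that `σ` puts on the upper tail of length `p`. -/
def tailWeight (σ : ℝ → ℝ) (p : ℝ≥0∞) : ℝ≥0∞ :=
  ∫⁻ u in Ioo (1 - p.toReal) 1, ENNReal.ofReal (σ u)

lemma tailWeight_ofReal (σ : ℝ → ℝ) {α : ℝ} (hα : α ≤ 1) :
    tailWeight σ (ENNReal.ofReal (1 - α)) = ∫⁻ u in Ioo α 1, ENNReal.ofReal (σ u) := by
  rw [tailWeight, ENNReal.toReal_ofReal (by linarith), sub_sub_cancel]

lemma tailWeight_mono (σ : ℝ → ℝ) {p q : ℝ≥0∞} (hpq : p ≤ q) (hq : q ≠ ∞) :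
    tailWeight σ p ≤ tailWeight σ q :=
  lintegral_mono_set (Ioo_subset_Ioo_left (sub_le_sub_left (ENNReal.toReal_mono hq hpq) 1))

@[simp]
lemma tailWeight_zero (σ : ℝ → ℝ) : tailWeight σ 0 = 0 := by
  simp [tailWeight]

variable {σ : ℝ → ℝ}

lemma IsDistortion.integrableOn (hσ : IsDistortion σ) : IntegrableOn σ (Ioo 0 1) := by
  by_contra h
  have := hσ.integral_one
  rw [integral_undef h] at this
  exact zero_ne_one this

lemma IsDistortion.aemeasurable (hσ : IsDistortion σ) :
    AEMeasurable (fun u => ENNReal.ofReal (σ u)) (volume.restrict (Ioo 0 1)) :=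
  hσ.integrableOn.aemeasurable.ennreal_ofReal

lemma IsDistortion.ofReal_setIntegral (hσ : IsDistortion σ) {α : ℝ} (hα : 0 ≤ α) :
    ENNReal.ofReal (∫ u in Ioo α 1, σ u) = ∫⁻ u in Ioo α 1, ENNReal.ofReal (σ u) := by
  refine ofReal_integral_eq_lintegral_ofReal
    (hσ.integrableOn.mono_set (Ioo_subset_Ioo_left hα)) ?_
  filter_upwards [ae_restrict_mem measurableSet_Ioo] with u hu
  exact hσ.nonneg u ⟨hα.trans hu.1.le, hu.2⟩

@[simp]
lemma IsDistortion.tailWeight_one (hσ : IsDistortion σ) : tailWeight σ 1 = 1 := by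
  have := hσ.ofReal_setIntegral le_rfl
  rw [hσ.integral_one] at this
  simpa [tailWeight] using this.symm

lemma IsDistortion.tailWeight_le_one (hσ : IsDistortion σ) {p : ℝ≥0∞} (hp : p ≤ 1) :
    tailWeight σ p ≤ 1 :=
  (tailWeight_mono σ hp ENNReal.one_ne_top).trans_eq hσ.tailWeight_one

lemma IsDistortion.tailWeight_ne_zero (hσ : IsDistortion σ) {p : ℝ≥0∞} (hp : p ≤ 1)
    (hp0 : p ≠ 0) : tailWeight σ p ≠ 0 := by
  intro h
  have hpr : 0 < p.toReal := ENNReal.toReal_pos hp0 (hp.trans_lt ENNReal.one_lt_top).ne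
  have hp1 : p.toReal ≤ 1 := by simpa using ENNReal.toReal_mono ENNReal.one_ne_top hp
  have hsub : Ioo (1 - p.toReal) 1 ⊆ Ioo 0 1 := Ioo_subset_Ioo_left (by linarith)
  rw [tailWeight, lintegral_eq_zero_iff' (hσ.aemeasurable.mono_set hsub)] at h
  have hz : ∀ u ∈ Ioo (0 : ℝ) 1, σ u = 0 := by
    intro u hu
    have hlt : max u (1 - p.toReal) < 1 := max_lt hu.2 (by linarith)
    have h' : ∀ᵐ v ∂volume.restrict (Ioo (max u (1 - p.toReal)) 1), ENNReal.ofReal (σ v) = 0 :=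
      ae_mono (Measure.restrict_mono (Ioo_subset_Ioo_left (le_max_right _ _)) le_rfl) h
    have hne : (ae (volume.restrict (Ioo (max u (1 - p.toReal)) 1))).NeBot := by
      rw [ae_neBot, Ne, Measure.restrict_eq_zero, Real.volume_Ioo]
      simpa using hlt
    obtain ⟨v, hv, hvm⟩ := (h'.and (ae_restrict_mem measurableSet_Ioo)).exists
    have hv0 : σ v ≤ 0 := ENNReal.ofReal_eq_zero.1 hv
    have huv : u < v := (le_max_left _ _).trans_lt hvm.1
    refine le_antisymm ?_ (hσ.nonneg u ⟨hu.1.le, hu.2⟩)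
    exact (hσ.mono ⟨hu.1.le, hu.2⟩ ⟨hu.1.le.trans huv.le, hvm.2⟩ huv.le).trans hv0
  have := hσ.integral_one
  rw [setIntegral_congr_fun measurableSet_Ioo hz] at this
  simp at this

lemma IsDistortion.tendsto_tailWeight (hσ : IsDistortion σ) {ι : Type*} {l : Filter ι}
    {p : ι → ℝ≥0∞} (hp1 : ∀ i, p i ≤ 1) (hp : Tendsto p l (𝓝 0)) :
    Tendsto (fun i => tailWeight σ (p i)) l (𝓝 0) := by
  have hfin : ∫⁻ u in Ioo 0 1, ENNReal.ofReal (σ u) ≠ ∞ := by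
    have := hσ.tailWeight_one
    simp only [tailWeight, ENNReal.toReal_one, sub_self] at this
    simp [this]
  have hsub : ∀ i, Ioo (1 - (p i).toReal) 1 ⊆ Ioo 0 1 := fun i => Ioo_subset_Ioo_left (by
    have : (p i).toReal ≤ 1 := by simpa using ENNReal.toReal_mono ENNReal.one_ne_top (hp1 i)
    linarith)
  have key := tendsto_setLIntegral_zero hfin (l := l) (s := fun i => Ioo (1 - (p i).toReal) 1) (by
    refine hp.congr fun i => ?_
    simp only [Function.comp]
    rw [Measure.restrict_apply measurableSet_Ioo, inter_eq_left.2 (hsub i), Real.volume_Ioo,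
      sub_sub_cancel, ENNReal.ofReal_toReal ((hp1 i).trans_lt ENNReal.one_lt_top).ne])
  refine key.congr fun i => ?_
  rw [tailWeight, Measure.restrict_restrict measurableSet_Ioo, inter_eq_left.2 (hsub i)]

variable {P : Measure Ω} [IsProbabilityMeasure P] {U : Ω → ℝ}

lemma IsDistortion.aemeasurable_comp (hσ : IsDistortion σ) (hU : IsUniformRV P U) :
    AEMeasurable (fun ω => ENNReal.ofReal (σ (U ω))) P :=
  (show AEMeasurable (fun u => ENNReal.ofReal (σ u)) (P.map U) from
    hU.map_eq ▸ hσ.aemeasurable).comp_measurable hU.1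

lemma IsDistortion.setLIntegral_uniform_gt (hσ : IsDistortion σ) (hU : IsUniformRV P U) {α : ℝ}
    (hα : α ∈ Icc (0 : ℝ) 1) :
    ∫⁻ ω in {ω | α < U ω}, ENNReal.ofReal (σ (U ω)) ∂P
      = tailWeight σ (ENNReal.ofReal (1 - α)) := by
  have hr : (P.restrict {ω | α < U ω}).map U = volume.restrict (Ioo α 1) := by
    have := Measure.restrict_map (μ := P) hU.1 (measurableSet_Ioi (a := α))
    rw [hU.map_eq, Measure.restrict_restrict measurableSet_Ioi] at this
    rw [show {ω | α < U ω} = U ⁻¹' Ioi α from rfl, ← this]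
    congr 1
    ext u
    simp only [mem_inter_iff, mem_Ioi, mem_Ioo]
    exact ⟨fun h => ⟨h.1, h.2.2⟩, fun h => ⟨h.1, hα.1.trans_lt h.1, h.2⟩⟩
  rw [tailWeight_ofReal σ hα.2, ← hr, lintegral_map' _ hU.1.aemeasurable]
  rw [hr]
  exact hσ.aemeasurable.mono_set (Ioo_subset_Ioo_left hα.1)

lemma IsDistortion.setLIntegral_le_tailWeight (hσ : IsDistortion σ) (hU : IsUniformRV P U)
    {A : Set Ω} (hA : MeasurableSet A) :
    ∫⁻ ω in A, ENNReal.ofReal (σ (U ω)) ∂P ≤ tailWeight σ (P A) := by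
  rcases eq_or_ne (P A) 0 with h0 | h0
  · rw [setLIntegral_measure_zero _ _ h0]
    exact zero_le
  have hpos : 0 < P.real A := ENNReal.toReal_pos h0 (measure_ne_top _ _)
  set α := 1 - P.real A with hα
  have hα1 : α ∈ Ico (0 : ℝ) 1 :=
    ⟨sub_nonneg.2 measureReal_le_one, by linarith⟩
  have hPA : P A = ENNReal.ofReal (1 - α) := by
    rw [hα, sub_sub_cancel, ofReal_measureReal]
  set B := {ω | α < U ω} with hB
  have hBm : MeasurableSet B := measurableSet_lt measurable_const hU.1
  have hPB : P B = P A := by rw [hPA, hU.measure_gt ⟨hα1.1, hα1.2.le⟩]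
  rw [hPA, ← hσ.setLIntegral_uniform_gt hU ⟨hα1.1, hα1.2.le⟩, ← hB,
    ← lintegral_inter_add_sdiff _ A hBm, ← lintegral_inter_add_sdiff _ B hA, inter_comm]
  refine add_le_add le_rfl ?_
  have hdiff : P (A \ B) = P (B \ A) := by
    have h1 := measure_inter_add_sdiff (μ := P) A hBm
    have h2 := measure_inter_add_sdiff (μ := P) B hA
    rw [inter_comm, hPB, ← h1] at h2
    exact ((ENNReal.add_right_inj (measure_ne_top _ _)).1 h2).symm
  have hlt : ∀ᵐ ω ∂P, U ω < 1 := by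
    have : P {ω | U ω = 1} = 0 := measure_eq_of_uniform hU 1
    filter_upwards [measure_eq_zero_iff_ae_notMem.1 this] with ω hω
    exact lt_of_le_of_ne (hU.2.1 ω).2 hω
  calc ∫⁻ ω in A \ B, ENNReal.ofReal (σ (U ω)) ∂P
      ≤ ∫⁻ _ in A \ B, ENNReal.ofReal (σ α) ∂P := by
        refine setLIntegral_mono' (hA.diff hBm) fun ω hω => ENNReal.ofReal_le_ofReal ?_
        have : U ω ≤ α := not_lt.1 hω.2
        exact hσ.mono ⟨(hU.2.1 ω).1, this.trans_lt hα1.2⟩ hα1 this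
    _ = ∫⁻ _ in B \ A, ENNReal.ofReal (σ α) ∂P := by
        rw [setLIntegral_const, setLIntegral_const, hdiff]
    _ ≤ ∫⁻ ω in B \ A, ENNReal.ofReal (σ (U ω)) ∂P := by
        refine lintegral_mono_ae ?_
        filter_upwards [ae_restrict_mem (hBm.diff hA), ae_restrict_of_ae hlt] with ω hω h1
        have : α < U ω := hω.1
        exact ENNReal.ofReal_le_ofReal (hσ.mono hα1 ⟨(hU.2.1 ω).1, h1⟩ this.le)

lemma lintegral_mul_ofReal_eq_lintegral_setLIntegral {w : Ω → ℝ≥0∞} (hw : AEMeasurable w P)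
    {g : Ω → ℝ} (hg : AEMeasurable g P) (hg0 : 0 ≤ g) :
    ∫⁻ ω, w ω * ENNReal.ofReal (g ω) ∂P = ∫⁻ t in Ioi 0, ∫⁻ ω in {ω | t < g ω}, w ω ∂P := by
  have h := lintegral_withDensity_eq_lintegral_mul₀ hw hg.ennreal_ofReal
  simp only [Pi.mul_apply] at h
  rw [← h, lintegral_eq_lintegral_meas_lt _ (Eventually.of_forall hg0)
    (hg.mono_ac (withDensity_absolutelyContinuous _ _))]
  simp only [withDensity_apply' w]

end TailWeight

section AvarTail

/-- `∫_0^∞ min(p, P(g > s)) ds`, the integral of the nonnegative random variable `g` over its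
upper tail of probability `p`. -/
def avarTail (P : Measure Ω) (g : Ω → ℝ) (p : ℝ≥0∞) : ℝ≥0∞ :=
  ∫⁻ s in Ioi 0, min p (P {ω | s < g ω})

variable {P : Measure Ω} {g : Ω → ℝ}

lemma avarTail_zero (P : Measure Ω) (g : Ω → ℝ) : avarTail P g 0 = 0 := by
  simp [avarTail]

lemma setLIntegral_le_avarTail (hg : AEMeasurable g P) (hg0 : 0 ≤ g) {A : Set Ω}
    (hA : NullMeasurableSet A P) :
    ∫⁻ ω in A, ENNReal.ofReal (g ω) ∂P ≤ avarTail P g (P A) := by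
  rw [lintegral_eq_lintegral_meas_lt _ (Eventually.of_forall hg0) hg.restrict, avarTail]
  refine lintegral_mono fun s => le_min ?_ (Measure.restrict_apply_le _ _)
  rw [Measure.restrict_apply₀' hA]
  exact measure_mono inter_subset_right

lemma avarTail_le_lintegral (hg : AEMeasurable g P) (hg0 : 0 ≤ g) (p : ℝ≥0∞) :
    avarTail P g p ≤ ∫⁻ ω, ENNReal.ofReal (g ω) ∂P := by
  rw [lintegral_eq_lintegral_meas_lt _ (Eventually.of_forall hg0) hg, avarTail]
  exact lintegral_mono fun s => min_le_right _ _

variable [IsProbabilityMeasure P]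

lemma measure_le_eq_ofReal_cdf (hg : AEMeasurable g P) (q : ℝ) :
    P {ω | g ω ≤ q} = ENNReal.ofReal (cdf (P.map g) q) := by
  have := Measure.isProbabilityMeasure_map hg
  rw [ofReal_cdf, Measure.map_apply_of_aemeasurable hg measurableSet_Iic]
  rfl

lemma measure_lt_eq_ofReal_cdf (hg : AEMeasurable g P) (s : ℝ) :
    P {ω | s < g ω} = ENNReal.ofReal (1 - cdf (P.map g) s) := by
  have h : {ω | s < g ω} = {ω | g ω ≤ s}ᶜ := by ext; simp
  rw [h, prob_compl_eq_one_sub₀ (nullMeasurableSet_le hg aemeasurable_const),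
    measure_le_eq_ofReal_cdf hg, ENNReal.ofReal_sub _ (cdf_nonneg _ _), ENNReal.ofReal_one]

lemma quantileFn_eq_sInf_cdf (hg : AEMeasurable g P) (u : ℝ) (hu : 0 < u) :
    quantileFn P g u = sInf {q | u ≤ cdf (P.map g) q} := by
  rw [quantileFn]
  congr 1
  ext q
  simp only [mem_ofPred_eq]
  rw [measure_le_eq_ofReal_cdf hg]
  refine ⟨fun h => ?_, fun h => ENNReal.ofReal_le_ofReal h⟩
  by_contra! hc
  exact absurd h (not_le.2 ((ENNReal.ofReal_lt_ofReal_iff hu).2 hc))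

lemma bddBelow_le_cdf (μ : Measure ℝ) {u : ℝ} (hu : 0 < u) :
    BddBelow {q | u ≤ cdf μ q} := by
  obtain ⟨a, ha⟩ := ((tendsto_cdf_atBot μ).eventually (gt_mem_nhds hu)).exists
  refine ⟨a, fun q hq => ?_⟩
  by_contra! h
  exact absurd (hq.trans (monotone_cdf μ h.le)) (not_le.2 ha)

lemma nonempty_le_cdf (μ : Measure ℝ) {u : ℝ} (hu : u < 1) :
    {q | u ≤ cdf μ q}.Nonempty := by
  obtain ⟨b, hb⟩ := ((tendsto_cdf_atTop μ).eventually (lt_mem_nhds hu)).exists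
  exact ⟨b, hb.le⟩

lemma lt_quantileFn_iff (hg : AEMeasurable g P) {u : ℝ} (hu : u ∈ Ioo (0 : ℝ) 1) (s : ℝ) :
    s < quantileFn P g u ↔ cdf (P.map g) s < u := by
  rw [quantileFn_eq_sInf_cdf hg u hu.1]
  constructor
  · intro h
    by_contra! hc
    exact absurd (csInf_le (bddBelow_le_cdf _ hu.1) hc) (not_le.2 h)
  · intro h
    have hc : ContinuousWithinAt (cdf (P.map g)) (Ioi s) s :=
      ((cdf (P.map g)).right_continuous s).mono Ioi_subset_Ici_self
    obtain ⟨s', hs', hlt⟩ :=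
      ((hc.eventually (gt_mem_nhds h)).and self_mem_nhdsWithin).exists
    refine lt_of_lt_of_le hlt (le_csInf (nonempty_le_cdf _ hu.2) fun q hq => ?_)
    by_contra! hq'
    exact absurd (le_trans hq (monotone_cdf _ hq'.le)) (not_le.2 hs')

lemma lintegral_quantileFn (hg : AEMeasurable g P) (hg0 : 0 ≤ g) {α : ℝ}
    (hα : α ∈ Ico (0 : ℝ) 1) :
    ∫⁻ u in Ioo α 1, ENNReal.ofReal (quantileFn P g u)
      = avarTail P g (ENNReal.ofReal (1 - α)) := by
  have hsub : Ioo α 1 ⊆ Ioo 0 1 := Ioo_subset_Ioo_left hα.1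
  have hmono : MonotoneOn (quantileFn P g) (Ioo α 1) := by
    intro u hu v hv huv
    rw [quantileFn_eq_sInf_cdf hg u (hsub hu).1, quantileFn_eq_sInf_cdf hg v (hsub hv).1]
    exact csInf_le_csInf (bddBelow_le_cdf _ (hsub hu).1) (nonempty_le_cdf _ hv.2)
      fun q hq => huv.trans hq
  have hnn : 0 ≤ᵐ[volume.restrict (Ioo α 1)] quantileFn P g := by
    filter_upwards [ae_restrict_mem measurableSet_Ioo] with u hu
    refine Real.sInf_nonneg fun q hq => ?_
    by_contra! h
    have : {ω | g ω ≤ q} = ∅ := by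
      ext ω
      simpa using h.trans_le (hg0 ω)
    rw [mem_ofPred_eq, this, measure_empty, nonpos_iff_eq_zero, ENNReal.ofReal_eq_zero] at hq
    exact absurd (hsub hu).1 (not_lt.2 hq)
  rw [lintegral_eq_lintegral_meas_lt _ hnn
    (aemeasurable_restrict_of_monotoneOn measurableSet_Ioo hmono), avarTail]
  refine lintegral_congr fun s => ?_
  rw [Measure.restrict_apply' measurableSet_Ioo, measure_lt_eq_ofReal_cdf hg,
    ← ENNReal.ofReal_mono.map_min, min_sub_sub_left]
  have : {u | s < quantileFn P g u} ∩ Ioo α 1 = Ioo (max α (cdf (P.map g) s)) 1 := by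
    ext u
    simp only [mem_inter_iff, mem_ofPred_eq, mem_Ioo, max_lt_iff]
    constructor
    · rintro ⟨h1, h2⟩
      exact ⟨⟨h2.1, (lt_quantileFn_iff hg (hsub h2) s).1 h1⟩, h2.2⟩
    · rintro ⟨⟨h1, h2⟩, h3⟩
      exact ⟨(lt_quantileFn_iff hg (hsub ⟨h1, h3⟩) s).2 h2, h1, h3⟩
  rw [this, Real.volume_Ioo]

lemma avarTail_one (hg : AEMeasurable g P) (hg0 : 0 ≤ g) :
    avarTail P g 1 = ∫⁻ ω, ENNReal.ofReal (g ω) ∂P := by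
  rw [lintegral_eq_lintegral_meas_lt _ (Eventually.of_forall hg0) hg, avarTail]
  exact lintegral_congr fun s => min_eq_right prob_le_one

/-- The tail integral is attained on an upper level set of a comonotone uniform variable. -/
lemma exists_setLIntegral_eq_avarTail (hrich : ∃ V : Ω → ℝ, IsUniformRV P V)
    (hg : AEMeasurable g P) (hg0 : 0 ≤ g) {α : ℝ} (hα : α ∈ Icc (0 : ℝ) 1) :
    ∃ A, MeasurableSet A ∧ P A = ENNReal.ofReal (1 - α) ∧
      ∫⁻ ω in A, ENNReal.ofReal (g ω) ∂P = avarTail P g (ENNReal.ofReal (1 - α)) := by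
  obtain ⟨U, hU, hcom⟩ := exists_comonotone_uniform hrich hg.measurable_mk
  have hA : MeasurableSet {ω | α < U ω} := measurableSet_lt measurable_const hU.1
  refine ⟨{ω | α < U ω}, hA, hU.measure_gt hα, ?_⟩
  rw [lintegral_eq_lintegral_meas_lt _ (Eventually.of_forall hg0) hg.restrict, avarTail]
  refine lintegral_congr fun s => ?_
  set F := P.real {ω' | hg.mk g ω' ≤ s} with hF
  have hFI : F ∈ Icc (0 : ℝ) 1 := ⟨measureReal_nonneg, measureReal_le_one⟩
  have hae : {ω | s < g ω} =ᵐ[P] {ω | F < U ω} := by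
    refine EventuallyEq.trans ?_ (hcom s).symm
    filter_upwards [hg.ae_eq_mk] with ω hω
    exact congrArg (fun x => s < x) hω
  rw [Measure.restrict_apply' hA, measure_congr (hae.inter (ae_eq_refl {ω | α < U ω})),
    measure_congr hae,
    hU.measure_gt hFI, ← ENNReal.ofReal_mono.map_min, min_sub_sub_left, max_comm,
    ← hU.measure_gt ⟨hFI.1.trans (le_max_left _ _), max_le hFI.2 hα.2⟩]
  congr 1
  ext ω
  simp

end AvarTail

section SigmaNorm

variable {P : Measure Ω} {σ : ℝ → ℝ} {X : Type*} [NormedAddCommGroup X]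

lemma sigmaPow_one (P : Measure Ω) (σ : ℝ → ℝ) (Y : Ω → X) :
    sigmaPow P σ 1 Y = ⨆ (U : Ω → ℝ) (_ : IsUniformRV P U),
      ∫⁻ ω, ENNReal.ofReal (σ (U ω)) * ‖Y ω‖ₑ ∂P := by
  simp [sigmaPow, enorm_eq_nnnorm]

lemma sigmaNorm_one (P : Measure Ω) (σ : ℝ → ℝ) (Y : Ω → X) :
    sigmaNorm P σ 1 Y = sigmaPow P σ 1 Y := by
  simp [sigmaNorm]

lemma sigmaPow_one_mono {X' : Type*} [NormedAddCommGroup X'] {Y : Ω → X} {W : Ω → X'}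
    (h : ∀ ω, ‖Y ω‖ ≤ ‖W ω‖) : sigmaPow P σ 1 Y ≤ sigmaPow P σ 1 W := by
  rw [sigmaPow_one, sigmaPow_one]
  refine iSup₂_mono fun U _ => lintegral_mono fun ω => ?_
  gcongr
  exact enorm_le_iff_norm_le.2 (h ω)

lemma sigmaPow_one_const_smul {Y : Ω → X} {𝕜 : Type*} [RCLike 𝕜] [NormedSpace 𝕜 X] (c : 𝕜) :
    sigmaPow P σ 1 (c • Y) = ‖c‖ₑ * sigmaPow P σ 1 Y := by
  simp only [sigmaPow_one, ENNReal.mul_iSup, Pi.smul_apply, enorm_smul]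
  refine iSup_congr fun U => iSup_congr fun _ => ?_
  rw [← lintegral_const_mul' _ _ enorm_ne_top]
  exact lintegral_congr fun ω => mul_left_comm _ _ _

variable [IsProbabilityMeasure P]

lemma IsDistortion.sigmaPow_one_add_le (hσ : IsDistortion σ) {Y₁ Y₂ : Ω → X}
    (h₁ : AEStronglyMeasurable Y₁ P) :
    sigmaPow P σ 1 (Y₁ + Y₂) ≤ sigmaPow P σ 1 Y₁ + sigmaPow P σ 1 Y₂ := by
  simp only [sigmaPow_one]
  refine iSup₂_le fun U hU => ?_
  calc ∫⁻ ω, ENNReal.ofReal (σ (U ω)) * ‖(Y₁ + Y₂) ω‖ₑ ∂P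
      ≤ ∫⁻ ω, (ENNReal.ofReal (σ (U ω)) * ‖Y₁ ω‖ₑ + ENNReal.ofReal (σ (U ω)) * ‖Y₂ ω‖ₑ) ∂P := by
        refine lintegral_mono fun ω => ?_
        rw [← mul_add]
        gcongr
        exact enorm_add_le _ _
    _ = _ := lintegral_add_left' ((hσ.aemeasurable_comp hU).mul h₁.enorm) _
    _ ≤ _ := add_le_add
        (le_iSup₂ (f := fun (U : Ω → ℝ) (_ : IsUniformRV P U) =>
          ∫⁻ ω, ENNReal.ofReal (σ (U ω)) * ‖Y₁ ω‖ₑ ∂P) U hU)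
        (le_iSup₂ (f := fun (U : Ω → ℝ) (_ : IsUniformRV P U) =>
          ∫⁻ ω, ENNReal.ofReal (σ (U ω)) * ‖Y₂ ω‖ₑ ∂P) U hU)

/-- The supremum defining `‖Y‖_{σ,1}` is attained at a uniform variable comonotone with `‖Y‖`. -/
lemma IsDistortion.sigmaPow_one_eq (hσ : IsDistortion σ)
    (hrich : ∃ V : Ω → ℝ, IsUniformRV P V) {Y : Ω → X} (hY : AEStronglyMeasurable Y P) :
    sigmaPow P σ 1 Y = ∫⁻ t in Ioi 0, tailWeight σ (P {ω | t < ‖Y ω‖}) := by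
  have hg : AEMeasurable (fun ω => ‖Y ω‖) P := hY.norm.aemeasurable
  have hset : ∀ t : ℝ, {ω | t < ‖Y ω‖} =ᵐ[P] {ω | t < hg.mk _ ω} := fun t => by
    filter_upwards [hg.ae_eq_mk] with ω hω
    exact congrArg (fun x => t < x) hω
  have hlayer : ∀ U : Ω → ℝ, IsUniformRV P U →
      ∫⁻ ω, ENNReal.ofReal (σ (U ω)) * ‖Y ω‖ₑ ∂P
        = ∫⁻ t in Ioi 0, ∫⁻ ω in {ω | t < hg.mk _ ω}, ENNReal.ofReal (σ (U ω)) ∂P := by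
    intro U hU
    have := lintegral_mul_ofReal_eq_lintegral_setLIntegral (hσ.aemeasurable_comp hU) hg
      (fun ω => norm_nonneg _)
    simp only [ofReal_norm] at this
    rw [this]
    exact lintegral_congr fun t => by rw [Measure.restrict_congr_set (hset t)]
  simp only [measure_congr (hset _)]
  rw [sigmaPow_one]
  refine le_antisymm (iSup₂_le fun U hU => ?_) ?_
  · rw [hlayer U hU]
    exact lintegral_mono fun t => hσ.setLIntegral_le_tailWeight hU
      (measurableSet_lt measurable_const hg.measurable_mk)
  · obtain ⟨U, hU, hcom⟩ := exists_comonotone_uniform hrich hg.measurable_mk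
    refine le_iSup₂_of_le U hU ?_
    rw [hlayer U hU]
    refine lintegral_mono fun t => ?_
    have hI : P.real {ω' | hg.mk _ ω' ≤ t} ∈ Icc (0 : ℝ) 1 :=
      ⟨measureReal_nonneg, measureReal_le_one⟩
    rw [← Measure.restrict_congr_set (hcom t), ← measure_congr (hcom t), hU.measure_gt hI,
      hσ.setLIntegral_uniform_gt hU hI]

lemma IsDistortion.sigmaPow_one_le_of_norm_le (hσ : IsDistortion σ) {Y : Ω → X} {c : ℝ}
    (h : ∀ ω, ‖Y ω‖ ≤ c) : sigmaPow P σ 1 Y ≤ ENNReal.ofReal c := by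
  rw [sigmaPow_one]
  refine iSup₂_le fun U hU => ?_
  calc ∫⁻ ω, ENNReal.ofReal (σ (U ω)) * ‖Y ω‖ₑ ∂P
      ≤ ∫⁻ ω, ENNReal.ofReal (σ (U ω)) * ENNReal.ofReal c ∂P := by
        refine lintegral_mono fun ω => ?_
        rw [← ofReal_norm]
        gcongr
        exact h ω
    _ = (∫⁻ ω, ENNReal.ofReal (σ (U ω)) ∂P) * ENNReal.ofReal c :=
        lintegral_mul_const'' _ (hσ.aemeasurable_comp hU)
    _ ≤ 1 * ENNReal.ofReal c := by
        gcongr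
        have := hσ.setLIntegral_le_tailWeight hU MeasurableSet.univ
        rwa [measure_univ, hσ.tailWeight_one, setLIntegral_univ] at this
    _ = ENNReal.ofReal c := one_mul _

lemma IsDistortion.memLsigma_of_norm_le (hσ : IsDistortion σ) {Y : Ω → X}
    (hY : AEStronglyMeasurable Y P) {c : ℝ} (h : ∀ ω, ‖Y ω‖ ≤ c) : MemLsigma P σ 1 Y :=
  ⟨hY, (hσ.sigmaPow_one_le_of_norm_le h).trans_lt ENNReal.ofReal_lt_top⟩

lemma IsDistortion.sigmaPow_one_le_tailWeight (hσ : IsDistortion σ) {Y : Ω → X} {A : Set Ω}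
    (hA : MeasurableSet A) (hY : ∀ ω ∈ A, ‖Y ω‖ ≤ 1) (hY0 : ∀ ω ∉ A, Y ω = 0) :
    sigmaPow P σ 1 Y ≤ tailWeight σ (P A) := by
  rw [sigmaPow_one]
  refine iSup₂_le fun U hU => le_trans ?_ (hσ.setLIntegral_le_tailWeight hU hA)
  rw [← lintegral_indicator hA]
  refine lintegral_mono fun ω => ?_
  by_cases hω : ω ∈ A
  · rw [indicator_of_mem hω]
    refine mul_le_of_le_one_right zero_le ?_
    rw [← ofReal_norm]
    exact ENNReal.ofReal_le_one.2 (hY ω hω)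
  · simp [hω, hY0 ω hω]

lemma antitone_tailWeight_measure_lt (σ : ℝ → ℝ) (g : Ω → ℝ) :
    Antitone fun t : ℝ => tailWeight σ (P {ω | t < g ω}) := fun _ _ hst =>
  tailWeight_mono σ (measure_mono fun _ hω => lt_of_le_of_lt hst hω) (measure_ne_top _ _)

/-- Dominated convergence in `L_σ^1(P)`. -/
lemma IsDistortion.tendsto_sigmaPow_one_zero (hσ : IsDistortion σ)
    (hrich : ∃ V : Ω → ℝ, IsUniformRV P V) {Y : ℕ → Ω → X} {W : Ω → ℝ}
    (hY : ∀ n, AEStronglyMeasurable (Y n) P) (hW : MemLsigma P σ 1 W)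
    (hYW : ∀ n ω, ‖Y n ω‖ ≤ ‖W ω‖) (hlim : ∀ᵐ ω ∂P, Tendsto (fun n => Y n ω) atTop (𝓝 0)) :
    Tendsto (fun n => sigmaPow P σ 1 (Y n)) atTop (𝓝 0) := by
  simp only [hσ.sigmaPow_one_eq hrich (hY _)]
  have key := tendsto_lintegral_of_dominated_convergence' (μ := volume.restrict (Ioi (0 : ℝ)))
    (F := fun n t => tailWeight σ (P {ω | t < ‖Y n ω‖})) (f := fun _ => 0)
    (fun t => tailWeight σ (P {ω | t < ‖W ω‖}))
    (fun n => (antitone_tailWeight_measure_lt σ fun ω => ‖Y n ω‖).measurable.aemeasurable)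
    (fun n => Eventually.of_forall fun t => tailWeight_mono σ
      (measure_mono fun ω hω => lt_of_lt_of_le hω (hYW n ω)) (measure_ne_top _ _))
    (by rw [← hσ.sigmaPow_one_eq hrich hW.1]; exact hW.2.ne)
    (by
      filter_upwards [ae_restrict_mem measurableSet_Ioi] with t ht
      refine hσ.tendsto_tailWeight (fun _ => prob_le_one) ?_
      have hm := tendstoInMeasure_of_tendsto_ae hY hlim
      rw [tendstoInMeasure_iff_norm] at hm
      refine tendsto_of_tendsto_of_tendsto_of_le_of_le tendsto_const_nhds (hm t ht)
        (fun n => zero_le) fun n => measure_mono fun ω hω => ?_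
      have : t < ‖Y n ω‖ := hω
      simpa using this.le)
  simpa using key

end SigmaNorm

section SignTest

/-- The conjugate of the sign of `z`. -/
def signConj (z : 𝕂) : 𝕂 := (starRingEnd 𝕂) z * ((‖z‖⁻¹ : ℝ) : 𝕂)

lemma norm_signConj_le (z : 𝕂) : ‖signConj z‖ ≤ 1 := by
  rw [signConj, norm_mul, RCLike.norm_conj, RCLike.norm_ofReal, abs_inv, abs_norm]
  exact mul_inv_le_one

lemma mul_signConj (z : 𝕂) : z * signConj z = ((‖z‖ : ℝ) : 𝕂) := by
  rw [signConj, ← mul_assoc, RCLike.mul_conj, ← RCLike.ofReal_pow, ← RCLike.ofReal_mul]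
  rcases eq_or_ne ‖z‖ 0 with h | h
  · simp [h]
  · congr 1
    field_simp

lemma measurable_signConj : Measurable (signConj : 𝕂 → 𝕂) :=
  RCLike.continuous_conj.measurable.mul
    (RCLike.continuous_ofReal.measurable.comp measurable_norm.inv)

/-- The test variable detecting the mass of `Z` on `A`. -/
def signTest {Ω : Type*} (Z : Ω → 𝕂) (A : Set Ω) : Ω → 𝕂 := A.indicator fun ω => signConj (Z ω)

lemma norm_signTest_le {Ω : Type*} (Z : Ω → 𝕂) (A : Set Ω) (ω : Ω) : ‖signTest Z A ω‖ ≤ 1 := by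
  unfold signTest
  by_cases h : ω ∈ A
  · rw [indicator_of_mem h]
    exact norm_signConj_le _
  · simp [h]

variable {P : Measure Ω}

lemma aestronglyMeasurable_signTest {Z : Ω → 𝕂} (hZ : AEStronglyMeasurable Z P) {A : Set Ω}
    (hA : MeasurableSet A) : AEStronglyMeasurable (signTest Z A) P :=
  (measurable_signConj.comp_aemeasurable hZ.aemeasurable).aestronglyMeasurable.indicator hA

lemma ofReal_norm_integral_mul_signTest {Z : Ω → 𝕂} (hZ : Integrable Z P) {A : Set Ω}
    (hA : MeasurableSet A) :
    ENNReal.ofReal ‖∫ ω, Z ω * signTest Z A ω ∂P‖ = ∫⁻ ω in A, ENNReal.ofReal ‖Z ω‖ ∂P := by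
  have : (fun ω => Z ω * signTest Z A ω) = A.indicator fun ω => ((‖Z ω‖ : ℝ) : 𝕂) := by
    ext ω
    unfold signTest
    by_cases h : ω ∈ A
    · rw [indicator_of_mem h, indicator_of_mem h, mul_signConj]
    · simp [h]
  rw [this, integral_indicator hA, integral_ofReal, RCLike.norm_ofReal,
    abs_of_nonneg (integral_nonneg fun ω => norm_nonneg _),
    ofReal_integral_eq_lintegral_ofReal hZ.norm.restrict
      (Eventually.of_forall fun ω => norm_nonneg _)]

end SignTest

section DualNorm

variable {P : Measure Ω} {σ : ℝ → ℝ}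

lemma quantileFn_const_mul (P : Measure Ω) (g : Ω → ℝ) {r : ℝ} (hr : 0 < r) (u : ℝ) :
    quantileFn P (fun ω => r * g ω) u = r * quantileFn P g u := by
  rw [quantileFn, quantileFn, ← smul_eq_mul r, ← Real.sInf_smul_of_nonneg hr.le]
  congr 1
  ext q
  rw [mem_smul_set_iff_inv_smul_mem₀ hr.ne']
  simp only [mem_ofPred_eq, smul_eq_mul, inv_mul_eq_div, le_div_iff₀' hr]

lemma dualNormInf_const_smul [IsProbabilityMeasure P] (σ : ℝ → ℝ) (c : 𝕂) (Z : Ω → 𝕂) :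
    dualNormInf P σ (c • Z) = (‖c‖₊ : ℝ≥0∞) * dualNormInf P σ Z := by
  rcases eq_or_ne c 0 with rfl | hc
  · simp only [zero_smul, nnnorm_zero, ENNReal.coe_zero, zero_mul, dualNormInf]
    refine ENNReal.iSup_eq_zero.2 fun α => ENNReal.iSup_eq_zero.2 fun hα => ?_
    have := lintegral_quantileFn (P := P) (g := fun _ => 0) aemeasurable_const (fun _ => le_rfl) hα
    simp only [Pi.zero_apply, norm_zero]
    rw [this, ← nonpos_iff_eq_zero]
    refine (ENNReal.div_le_div_right (avarTail_le_lintegral (g := fun _ => 0) aemeasurable_const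
      (fun _ => le_rfl) _) _).trans ?_
    simp
  · have hc' : 0 < ‖c‖ := norm_pos_iff.2 hc
    simp only [dualNormInf, ENNReal.mul_iSup, Pi.smul_apply, norm_smul,
      quantileFn_const_mul P _ hc', ENNReal.ofReal_mul hc'.le]
    refine iSup_congr fun α => iSup_congr fun _ => ?_
    rw [lintegral_const_mul' _ _ ENNReal.ofReal_ne_top, mul_div_assoc, ofReal_norm,
      enorm_eq_nnnorm]

lemma dualNormInf_neg [IsProbabilityMeasure P] (σ : ℝ → ℝ) (Z : Ω → 𝕂) :
    dualNormInf P σ (-Z) = dualNormInf P σ Z := by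
  have := dualNormInf_const_smul (P := P) σ (-1 : 𝕂) Z
  simpa using this

variable [IsProbabilityMeasure P]

lemma IsDistortion.dualNormInf_le_iff (hσ : IsDistortion σ) {Z : Ω → 𝕂}
    (hZ : AEStronglyMeasurable Z P) {D : ℝ≥0∞} :
    dualNormInf P σ Z ≤ D ↔ ∀ p ≤ 1, avarTail P (fun ω => ‖Z ω‖) p ≤ D * tailWeight σ p := by
  have key : ∀ α ∈ Ico (0 : ℝ) 1,
      (∫⁻ u in Ioo α 1, ENNReal.ofReal (quantileFn P (fun ω => ‖Z ω‖) u)) /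
        ENNReal.ofReal (∫ u in Ioo α 1, σ u) ≤ D ↔
      avarTail P (fun ω => ‖Z ω‖) (ENNReal.ofReal (1 - α))
        ≤ D * tailWeight σ (ENNReal.ofReal (1 - α)) := by
    intro α hα
    have h1 : ENNReal.ofReal (1 - α) ≤ 1 := ENNReal.ofReal_le_one.2 (by linarith [hα.1])
    have h0 : ENNReal.ofReal (1 - α) ≠ 0 := (ENNReal.ofReal_pos.2 (by linarith [hα.2])).ne'
    rw [lintegral_quantileFn hZ.norm.aemeasurable (fun ω => norm_nonneg _) hα,
      hσ.ofReal_setIntegral hα.1, ← tailWeight_ofReal σ hα.2.le,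
      ENNReal.div_le_iff (hσ.tailWeight_ne_zero h1 h0)
        ((hσ.tailWeight_le_one h1).trans_lt ENNReal.one_lt_top).ne]
  rw [dualNormInf, iSup₂_le_iff]
  constructor
  · intro h p hp
    rcases eq_or_ne p 0 with rfl | hp0
    · simp [avarTail_zero]
    have hpt : p ≠ ∞ := (hp.trans_lt ENNReal.one_lt_top).ne
    have hp1 : p.toReal ≤ 1 := by simpa using ENNReal.toReal_mono ENNReal.one_ne_top hp
    have hα : 1 - p.toReal ∈ Ico (0 : ℝ) 1 :=
      ⟨by linarith, by linarith [ENNReal.toReal_pos hp0 hpt]⟩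
    have := (key _ hα).1 (h _ hα)
    rwa [sub_sub_cancel, ENNReal.ofReal_toReal hpt] at this
  · exact fun h α hα => (key α hα).2 (h _ (ENNReal.ofReal_le_one.2 (by linarith [hα.1])))

lemma avarTail_add_le (hrich : ∃ V : Ω → ℝ, IsUniformRV P V) {Z₁ Z₂ : Ω → 𝕂}
    (h₁ : AEStronglyMeasurable Z₁ P) (h₂ : AEStronglyMeasurable Z₂ P) {p : ℝ≥0∞} (hp : p ≤ 1) :
    avarTail P (fun ω => ‖(Z₁ + Z₂) ω‖) p
      ≤ avarTail P (fun ω => ‖Z₁ ω‖) p + avarTail P (fun ω => ‖Z₂ ω‖) p := by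
  have hp1 : p.toReal ≤ 1 := by simpa using ENNReal.toReal_mono ENNReal.one_ne_top hp
  obtain ⟨A, hA, hPA, hAe⟩ := exists_setLIntegral_eq_avarTail hrich
    (h₁.add h₂).norm.aemeasurable (fun ω => norm_nonneg _)
    (α := 1 - p.toReal) ⟨by linarith, by linarith [p.toReal_nonneg]⟩
  rw [sub_sub_cancel, ENNReal.ofReal_toReal (hp.trans_lt ENNReal.one_lt_top).ne] at hPA hAe
  rw [← hAe]
  calc ∫⁻ ω in A, ENNReal.ofReal ‖(Z₁ + Z₂) ω‖ ∂P
      ≤ ∫⁻ ω in A, (ENNReal.ofReal ‖Z₁ ω‖ + ENNReal.ofReal ‖Z₂ ω‖) ∂P := by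
        refine lintegral_mono fun ω => ?_
        simp only [ofReal_norm, Pi.add_apply]
        exact enorm_add_le _ _
    _ = _ := lintegral_add_left' h₁.norm.aemeasurable.ennreal_ofReal.restrict _
    _ ≤ _ := by
        rw [← hPA]
        exact add_le_add
          (setLIntegral_le_avarTail h₁.norm.aemeasurable (fun ω => norm_nonneg _)
            hA.nullMeasurableSet)
          (setLIntegral_le_avarTail h₂.norm.aemeasurable (fun ω => norm_nonneg _)
            hA.nullMeasurableSet)

lemma IsDistortion.dualNormInf_add_le (hσ : IsDistortion σ)
    (hrich : ∃ V : Ω → ℝ, IsUniformRV P V) {Z₁ Z₂ : Ω → 𝕂}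
    (h₁ : AEStronglyMeasurable Z₁ P) (h₂ : AEStronglyMeasurable Z₂ P) :
    dualNormInf P σ (Z₁ + Z₂) ≤ dualNormInf P σ Z₁ + dualNormInf P σ Z₂ := by
  rw [hσ.dualNormInf_le_iff (h₁.add h₂)]
  intro p hp
  rw [add_mul]
  exact (avarTail_add_le hrich h₁ h₂ hp).trans
    (add_le_add ((hσ.dualNormInf_le_iff h₁).1 le_rfl p hp)
      ((hσ.dualNormInf_le_iff h₂).1 le_rfl p hp))

lemma IsDistortion.lintegral_enorm_le_dualNormInf (hσ : IsDistortion σ) {Z : Ω → 𝕂}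
    (hZ : AEStronglyMeasurable Z P) : ∫⁻ ω, ‖Z ω‖ₑ ∂P ≤ dualNormInf P σ Z := by
  have := (hσ.dualNormInf_le_iff hZ).1 le_rfl 1 le_rfl
  rw [avarTail_one hZ.norm.aemeasurable (fun ω => norm_nonneg _), hσ.tailWeight_one,
    mul_one] at this
  simpa only [ofReal_norm] using this

lemma IsDistortion.integrable_of_dualNormInf_lt_top (hσ : IsDistortion σ) {Z : Ω → 𝕂}
    (hZ : AEStronglyMeasurable Z P) (h : dualNormInf P σ Z < ∞) : Integrable Z P :=
  ⟨hZ, (hσ.lintegral_enorm_le_dualNormInf hZ).trans_lt h⟩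

/-- Hölder's inequality for the pairing of `L_σ^1(P)` with `L*_{σ,∞}(P)`. -/
lemma IsDistortion.lintegral_enorm_mul_le (hσ : IsDistortion σ)
    (hrich : ∃ V : Ω → ℝ, IsUniformRV P V) {Z Y : Ω → 𝕂}
    (hZ : AEStronglyMeasurable Z P) (hY : AEStronglyMeasurable Y P) :
    ∫⁻ ω, ‖Z ω * Y ω‖ₑ ∂P ≤ dualNormInf P σ Z * sigmaPow P σ 1 Y := by
  have h := lintegral_mul_ofReal_eq_lintegral_setLIntegral hZ.enorm hY.norm.aemeasurable
    (fun ω => norm_nonneg _)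
  simp only [ofReal_norm] at h
  simp only [enorm_mul]
  rw [h, hσ.sigmaPow_one_eq hrich hY, ← lintegral_const_mul _
    (antitone_tailWeight_measure_lt σ fun ω => ‖Y ω‖).measurable]
  refine lintegral_mono fun t => ?_
  have hm : NullMeasurableSet {ω | t < ‖Y ω‖} P :=
    nullMeasurableSet_lt aemeasurable_const hY.norm.aemeasurable
  have := setLIntegral_le_avarTail hZ.norm.aemeasurable (fun ω => norm_nonneg _) hm
  simp only [ofReal_norm] at this
  exact this.trans ((hσ.dualNormInf_le_iff hZ).1 le_rfl _ prob_le_one)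

lemma IsDistortion.integrable_mul (hσ : IsDistortion σ)
    (hrich : ∃ V : Ω → ℝ, IsUniformRV P V) {Z Y : Ω → 𝕂}
    (hZ : AEStronglyMeasurable Z P) (hD : dualNormInf P σ Z < ∞) (hY : MemLsigma P σ 1 Y) :
    Integrable (fun ω => Z ω * Y ω) P :=
  ⟨hZ.mul hY.1, (hσ.lintegral_enorm_mul_le hrich hZ hY.1).trans_lt (ENNReal.mul_lt_top hD hY.2)⟩

lemma IsDistortion.ofReal_norm_integral_mul_le (hσ : IsDistortion σ)
    (hrich : ∃ V : Ω → ℝ, IsUniformRV P V) {Z Y : Ω → 𝕂}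
    (hZ : AEStronglyMeasurable Z P) (hY : AEStronglyMeasurable Y P) :
    ENNReal.ofReal ‖∫ ω, Z ω * Y ω ∂P‖ ≤ dualNormInf P σ Z * sigmaPow P σ 1 Y := by
  rw [ofReal_norm]
  exact (enorm_integral_le_lintegral_enorm _).trans (hσ.lintegral_enorm_mul_le hrich hZ hY)

lemma IsDistortion.dualNormInf_le_of_signTest (hσ : IsDistortion σ)
    (hrich : ∃ V : Ω → ℝ, IsUniformRV P V) {Z : Ω → 𝕂} (hZ : Integrable Z P) {D : ℝ≥0∞}
    (h : ∀ A, MeasurableSet A → P A ≠ 0 →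
      ENNReal.ofReal ‖∫ ω, Z ω * signTest Z A ω ∂P‖ ≤ D * tailWeight σ (P A)) :
    dualNormInf P σ Z ≤ D := by
  rw [hσ.dualNormInf_le_iff hZ.1]
  intro p hp
  rcases eq_or_ne p 0 with rfl | hp0
  · simp [avarTail_zero]
  have hp1 : p.toReal ≤ 1 := by simpa using ENNReal.toReal_mono ENNReal.one_ne_top hp
  obtain ⟨A, hA, hPA, hAe⟩ := exists_setLIntegral_eq_avarTail hrich
    hZ.1.norm.aemeasurable (fun ω => norm_nonneg _)
    (α := 1 - p.toReal) ⟨by linarith, by linarith [p.toReal_nonneg]⟩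
  rw [sub_sub_cancel, ENNReal.ofReal_toReal (hp.trans_lt ENNReal.one_lt_top).ne] at hPA hAe
  rw [← hAe, ← hPA, ← ofReal_norm_integral_mul_signTest hZ hA]
  exact h A hA (hPA ▸ hp0)

lemma IsDistortion.sigmaPow_one_signTest_le (hσ : IsDistortion σ) (Z : Ω → 𝕂) {A : Set Ω}
    (hA : MeasurableSet A) : sigmaPow P σ 1 (signTest Z A) ≤ tailWeight σ (P A) :=
  hσ.sigmaPow_one_le_tailWeight hA (fun ω _ => norm_signTest_le Z A ω)
    fun ω hω => by simp [signTest, hω]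

/-- The dual norm is the operator norm of `Y ↦ E(ZY)`. -/
lemma IsDistortion.dualNormInf_eq_iSup (hσ : IsDistortion σ)
    (hrich : ∃ V : Ω → ℝ, IsUniformRV P V) {Z : Ω → 𝕂}
    (hZ : AEStronglyMeasurable Z P) (hD : dualNormInf P σ Z < ∞) :
    dualNormInf P σ Z = ⨆ (Y : Ω → 𝕂) (_ : MemLsigma P σ 1 Y ∧ sigmaNorm P σ 1 Y ≤ 1),
      ENNReal.ofReal ‖∫ ω, Z ω * Y ω ∂P‖ := by
  refine le_antisymm ?_ (iSup₂_le fun Y hY => ?_)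
  · refine hσ.dualNormInf_le_of_signTest hrich (hσ.integrable_of_dualNormInf_lt_top hZ hD)
      fun A hA hA0 => ?_
    set T := tailWeight σ (P A) with hT
    have hT0 : T ≠ 0 := hσ.tailWeight_ne_zero prob_le_one hA0
    have hTt : T ≠ ∞ := ((hσ.tailWeight_le_one prob_le_one).trans_lt ENNReal.one_lt_top).ne
    have hTr : 0 < T.toReal := ENNReal.toReal_pos hT0 hTt
    set c : 𝕂 := ((T.toReal⁻¹ : ℝ) : 𝕂) with hc
    have hcn : ‖c‖ₑ = T⁻¹ := by
      rw [← ofReal_norm, hc, RCLike.norm_ofReal, abs_of_pos (inv_pos.2 hTr),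
        ENNReal.ofReal_inv_of_pos hTr, ENNReal.ofReal_toReal hTt]
    have hN : sigmaPow P σ 1 (c • signTest Z A) ≤ 1 := by
      rw [sigmaPow_one_const_smul, hcn]
      exact (mul_le_mul_right (hσ.sigmaPow_one_signTest_le Z hA) _).trans_eq
        (ENNReal.inv_mul_cancel hT0 hTt)
    have hmem : MemLsigma P σ 1 (c • signTest Z A) :=
      ⟨(aestronglyMeasurable_signTest hZ hA).const_smul c, hN.trans_lt ENNReal.one_lt_top⟩
    have hle := le_iSup₂ (f := fun (Y : Ω → 𝕂) (_ : MemLsigma P σ 1 Y ∧ sigmaNorm P σ 1 Y ≤ 1) =>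
      ENNReal.ofReal ‖∫ ω, Z ω * Y ω ∂P‖) (c • signTest Z A)
      ⟨hmem, by rwa [sigmaNorm_one]⟩
    have hint : ∫ ω, Z ω * (c • signTest Z A) ω ∂P = c * ∫ ω, Z ω * signTest Z A ω ∂P := by
      rw [← integral_const_mul]
      exact integral_congr_ae (Eventually.of_forall fun ω => mul_left_comm _ _ _)
    rw [hint, norm_mul, ENNReal.ofReal_mul (norm_nonneg _), ofReal_norm, hcn] at hle
    rw [mul_comm]
    exact (ENNReal.inv_mul_le_iff hT0 hTt).1 hle
  · refine (hσ.ofReal_norm_integral_mul_le hrich hZ hY.1.1).trans ?_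
    have := hY.2
    rw [sigmaNorm_one] at this
    exact mul_le_of_le_one_right zero_le this

lemma IsDistortion.ae_eq_zero_of_dualNormInf_eq_zero (hσ : IsDistortion σ) {Z : Ω → 𝕂}
    (hZ : AEStronglyMeasurable Z P) (h : dualNormInf P σ Z = 0) : Z =ᵐ[P] 0 := by
  have := hσ.lintegral_enorm_le_dualNormInf hZ
  rw [h, nonpos_iff_eq_zero, lintegral_eq_zero_iff' hZ.enorm] at this
  filter_upwards [this] with ω hω
  simpa using hω

lemma IsDistortion.dualNormInf_complete (hσ : IsDistortion σ)
    (hrich : ∃ V : Ω → ℝ, IsUniformRV P V) {Zs : ℕ → Ω → 𝕂}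
    (hZs : ∀ n, AEStronglyMeasurable (Zs n) P ∧ dualNormInf P σ (Zs n) < ∞)
    (hcau : ∀ ε : ℝ≥0∞, 0 < ε → ∃ N : ℕ, ∀ m n : ℕ, N ≤ m → N ≤ n →
      dualNormInf P σ (Zs m - Zs n) < ε) :
    ∃ Z : Ω → 𝕂, AEStronglyMeasurable Z P ∧ dualNormInf P σ Z < ∞ ∧
      Tendsto (fun n => dualNormInf P σ (Zs n - Z)) atTop (𝓝 0) := by
  have hL : ∀ n, MemLp (Zs n) 1 P := fun n =>
    memLp_one_iff_integrable.2 (hσ.integrable_of_dualNormInf_lt_top (hZs n).1 (hZs n).2)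
  have hC : CauchySeq fun n => (hL n).toLp (Zs n) := by
    refine EMetric.cauchySeq_iff.2 fun ε hε => ?_
    obtain ⟨N, hN⟩ := hcau ε hε
    refine ⟨N, fun m hm n hn => ?_⟩
    rw [Lp.edist_toLp_toLp, eLpNorm_one_eq_lintegral_enorm]
    exact (hσ.lintegral_enorm_le_dualNormInf ((hZs m).1.sub (hZs n).1)).trans_lt (hN m n hm hn)
  obtain ⟨L, hlim⟩ := cauchySeq_tendsto_of_complete hC
  have hZ : AEStronglyMeasurable L P := Lp.aestronglyMeasurable L
  have hlim' : Tendsto (fun m => ∫⁻ ω, ‖(Zs m - L) ω‖ₑ ∂P) atTop (𝓝 0) := by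
    have := (Lp.tendsto_Lp_iff_tendsto_eLpNorm' _ _).1 hlim
    refine this.congr fun m => ?_
    rw [eLpNorm_one_eq_lintegral_enorm]
    refine lintegral_congr_ae ?_
    filter_upwards [(hL m).coeFn_toLp] with ω hω
    simp [hω]
  have hbound : ∀ ε : ℝ≥0∞, 0 < ε →
      ∃ N : ℕ, ∀ n, N ≤ n → dualNormInf P σ (Zs n - (L : Ω → 𝕂)) ≤ ε := by
    intro ε hε
    obtain ⟨N, hN⟩ := hcau ε hε
    refine ⟨N, fun n hn => ?_⟩
    rw [hσ.dualNormInf_le_iff ((hZs n).1.sub hZ)]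
    intro p hp
    have hlim'' : Tendsto (fun m => ε * tailWeight σ p + ∫⁻ ω, ‖(Zs m - L) ω‖ₑ ∂P) atTop
        (𝓝 (ε * tailWeight σ p)) := by
      simpa using hlim'.const_add (ε * tailWeight σ p)
    refine ge_of_tendsto hlim'' ?_
    filter_upwards [eventually_ge_atTop N] with m hm
    rw [← sub_add_sub_cancel (Zs n) (Zs m) (L : Ω → 𝕂)]
    refine (avarTail_add_le hrich ((hZs n).1.sub (hZs m).1) ((hZs m).1.sub hZ) hp).trans
      (add_le_add ?_ ?_)
    · exact (hσ.dualNormInf_le_iff ((hZs n).1.sub (hZs m).1)).1 (hN n m hn hm).le p hp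
    · simp only [← ofReal_norm]
      exact avarTail_le_lintegral ((hZs m).1.sub hZ).norm.aemeasurable (fun ω => norm_nonneg _) p
  refine ⟨L, hZ, ?_, ENNReal.tendsto_atTop_zero.2 hbound⟩
  obtain ⟨N, hN⟩ := hbound 1 one_pos
  rw [← sub_sub_cancel (Zs N) (L : Ω → 𝕂), sub_eq_add_neg]
  refine (hσ.dualNormInf_add_le hrich (hZs N).1 ((hZs N).1.sub hZ).neg).trans_lt ?_
  rw [dualNormInf_neg]
  exact ENNReal.add_lt_top.2 ⟨(hZs N).2, (hN N le_rfl).trans_lt ENNReal.one_lt_top⟩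

end DualNorm

section Surjectivity

/-- A `C`-bounded linear functional on `L_σ^1(P)`, given on representatives. -/
structure IsBoundedFunctional (P : Measure Ω) (σ : ℝ → ℝ) (φ : (Ω → 𝕂) → 𝕂) (C : ℝ≥0) :
    Prop where
  map_add : ∀ Y₁ Y₂, MemLsigma P σ 1 Y₁ → MemLsigma P σ 1 Y₂ → φ (Y₁ + Y₂) = φ Y₁ + φ Y₂
  map_smul : ∀ (c : 𝕂) Y, MemLsigma P σ 1 Y → φ (c • Y) = c * φ Y
  map_ae : ∀ Y₁ Y₂, MemLsigma P σ 1 Y₁ → Y₁ =ᵐ[P] Y₂ → φ Y₁ = φ Y₂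
  enorm_le : ∀ Y, MemLsigma P σ 1 Y → ‖φ Y‖ₑ ≤ C * sigmaPow P σ 1 Y

variable {P : Measure Ω} {σ : ℝ → ℝ} {φ : (Ω → 𝕂) → 𝕂} {C : ℝ≥0}

lemma MemLsigma.const_smul (c : 𝕂) {Y : Ω → 𝕂} (hY : MemLsigma P σ 1 Y) :
    MemLsigma P σ 1 (c • Y) :=
  ⟨hY.1.const_smul c, by
    rw [sigmaPow_one_const_smul]
    exact ENNReal.mul_lt_top enorm_lt_top hY.2⟩

lemma MemLsigma.congr_ae {Y₁ Y₂ : Ω → 𝕂} (h : MemLsigma P σ 1 Y₁) (hae : Y₁ =ᵐ[P] Y₂) :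
    MemLsigma P σ 1 Y₂ := by
  refine ⟨h.1.congr hae, lt_of_eq_of_lt ?_ h.2⟩
  rw [sigmaPow_one, sigmaPow_one]
  refine iSup_congr fun U => iSup_congr fun _ => lintegral_congr_ae ?_
  filter_upwards [hae] with ω hω
  rw [hω]

lemma IsBoundedFunctional.map_zero (hφ : IsBoundedFunctional P σ φ C)
    (h0 : MemLsigma P σ 1 (0 : Ω → 𝕂)) : φ 0 = 0 := by
  have := hφ.map_smul 0 0 h0
  rwa [smul_zero, zero_mul] at this

lemma IsBoundedFunctional.map_sub (hφ : IsBoundedFunctional P σ φ C) {Y₁ Y₂ : Ω → 𝕂}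
    (h₁ : MemLsigma P σ 1 Y₁) (h₂ : MemLsigma P σ 1 Y₂) : φ (Y₁ - Y₂) = φ Y₁ - φ Y₂ := by
  rw [sub_eq_add_neg, ← neg_one_smul 𝕂 Y₂, hφ.map_add _ _ h₁ (h₂.const_smul _),
    hφ.map_smul _ _ h₂]
  ring

variable [IsProbabilityMeasure P]

lemma MemLsigma.add (hσ : IsDistortion σ) {Y₁ Y₂ : Ω → 𝕂} (h₁ : MemLsigma P σ 1 Y₁)
    (h₂ : MemLsigma P σ 1 Y₂) : MemLsigma P σ 1 (Y₁ + Y₂) :=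
  ⟨h₁.1.add h₂.1, (hσ.sigmaPow_one_add_le h₁.1).trans_lt (ENNReal.add_lt_top.2 ⟨h₁.2, h₂.2⟩)⟩

lemma MemLsigma.sub (hσ : IsDistortion σ) {Y₁ Y₂ : Ω → 𝕂} (h₁ : MemLsigma P σ 1 Y₁)
    (h₂ : MemLsigma P σ 1 Y₂) : MemLsigma P σ 1 (Y₁ - Y₂) := by
  rw [sub_eq_add_neg, ← neg_one_smul 𝕂 Y₂]
  exact h₁.add hσ (h₂.const_smul _)

lemma IsDistortion.memLsigma_indicator (hσ : IsDistortion σ) {A : Set Ω} (hA : MeasurableSet A) :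
    MemLsigma P σ 1 (A.indicator (1 : Ω → 𝕂)) := by
  refine hσ.memLsigma_of_norm_le (c := 1) (aestronglyMeasurable_one.indicator hA) fun ω => ?_
  by_cases h : ω ∈ A <;> simp [h]

lemma IsDistortion.memLsigma_simpleFunc (hσ : IsDistortion σ) (f : SimpleFunc Ω 𝕂) :
    MemLsigma P σ 1 (f : Ω → 𝕂) := by
  obtain ⟨c, hc⟩ := f.exists_forall_norm_le
  exact hσ.memLsigma_of_norm_le f.aestronglyMeasurable hc

lemma IsBoundedFunctional.tendsto (hσ : IsDistortion σ) (hφ : IsBoundedFunctional P σ φ C)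
    {Y : ℕ → Ω → 𝕂} {Y₀ : Ω → 𝕂} (hY : ∀ n, MemLsigma P σ 1 (Y n)) (h₀ : MemLsigma P σ 1 Y₀)
    (hlim : Tendsto (fun n => sigmaPow P σ 1 (Y n - Y₀)) atTop (𝓝 0)) :
    Tendsto (fun n => φ (Y n)) atTop (𝓝 (φ Y₀)) := by
  rw [tendsto_iff_edist_tendsto_0]
  have h : Tendsto (fun n => (C : ℝ≥0∞) * sigmaPow P σ 1 (Y n - Y₀)) atTop (𝓝 0) := by
    simpa using ENNReal.Tendsto.const_mul hlim (Or.inr ENNReal.coe_ne_top)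
  refine tendsto_of_tendsto_of_tendsto_of_le_of_le tendsto_const_nhds h (fun _ => zero_le)
    fun n => ?_
  simp only [edist_eq_enorm_sub]
  rw [← hφ.map_sub (hY n) h₀]
  exact hφ.enorm_le _ ((hY n).sub hσ h₀)

lemma IsBoundedFunctional.enorm_indicator_le (hσ : IsDistortion σ)
    (hφ : IsBoundedFunctional P σ φ C) {A : Set Ω} (hA : MeasurableSet A) :
    ‖φ (A.indicator 1)‖ₑ ≤ C * tailWeight σ (P A) := by
  refine (hφ.enorm_le _ (hσ.memLsigma_indicator hA)).trans ?_
  gcongr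
  exact hσ.sigmaPow_one_le_tailWeight hA (fun ω h => by simp [h]) fun ω h => by simp [h]

lemma IsBoundedFunctional.map_indicator_union (hσ : IsDistortion σ)
    (hφ : IsBoundedFunctional P σ φ C) {A B : Set Ω} (hA : MeasurableSet A)
    (hB : MeasurableSet B) (hAB : Disjoint A B) :
    φ ((A ∪ B).indicator 1) = φ (A.indicator 1) + φ (B.indicator 1) := by
  rw [← hφ.map_add _ _ (hσ.memLsigma_indicator hA) (hσ.memLsigma_indicator hB)]
  congr 1
  exact indicator_union_of_disjoint hAB _

lemma IsBoundedFunctional.map_indicator_biUnion (hσ : IsDistortion σ)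
    (hφ : IsBoundedFunctional P σ φ C) {f : ℕ → Set Ω} (hf : ∀ i, MeasurableSet (f i))
    (hd : Pairwise (Function.onFun Disjoint f)) (s : Finset ℕ) :
    φ ((⋃ i ∈ s, f i).indicator 1) = ∑ i ∈ s, φ ((f i).indicator 1) := by
  induction s using Finset.induction_on with
  | empty =>
    have h0 : MemLsigma P σ 1 (0 : Ω → 𝕂) :=
      hσ.memLsigma_of_norm_le (c := 0) aestronglyMeasurable_zero (by simp)
    simpa [Pi.zero_def] using hφ.map_zero h0
  | insert a s ha ih =>
    rw [Finset.sum_insert ha, ← ih, Finset.set_biUnion_insert]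
    refine hφ.map_indicator_union hσ (hf a) (s.measurableSet_biUnion fun i _ => hf i) ?_
    exact disjoint_iUnion₂_right.2 fun i hi => hd fun h => ha (h ▸ hi)

open Classical in
/-- The vector measure `A ↦ φ(1_A)`. -/
def IsBoundedFunctional.toVectorMeasure (hσ : IsDistortion σ)
    (hφ : IsBoundedFunctional P σ φ C) : VectorMeasure Ω 𝕂 where
  measureOf' A := if MeasurableSet A then φ (A.indicator 1) else 0
  empty' := by simpa using hφ.map_indicator_biUnion hσ (f := fun _ => ∅) (by simp) (by
    intro i j _; simp [Function.onFun]) ∅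
  not_measurable' _ h := if_neg h
  m_iUnion' := by
    intro f hf hd
    have hU : MeasurableSet (⋃ i, f i) := MeasurableSet.iUnion hf
    have hF : ∀ s : Finset ℕ, MeasurableSet (⋃ i ∈ s, f i) := fun s =>
      s.measurableSet_biUnion fun i _ => hf i
    simp only [hf, hU, if_true]
    rw [HasSum, tendsto_iff_edist_tendsto_0]
    have hP : Tendsto (fun s : Finset ℕ => P ((⋃ i, f i) \ ⋃ i ∈ s, f i)) atTop (𝓝 0) := by
      have h1 := (ENNReal.summable (f := fun i => P (f i))).hasSum
      rw [← measure_iUnion hd hf] at h1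
      have h2 := ENNReal.Tendsto.sub (tendsto_const_nhds (x := P (⋃ i, f i)) (f := atTop)) h1
        (Or.inl (measure_ne_top _ _))
      rw [tsub_self] at h2
      refine h2.congr fun s => ?_
      rw [measure_sdiff (iUnion₂_subset fun i _ => subset_iUnion f i)
        (hF s).nullMeasurableSet (measure_ne_top _ _),
        measure_biUnion_finset (hd.set_pairwise _) fun i _ => hf i]
    have h : Tendsto (fun s : Finset ℕ =>
        (C : ℝ≥0∞) * tailWeight σ (P ((⋃ i, f i) \ ⋃ i ∈ s, f i))) atTop (𝓝 0) := by
      simpa using ENNReal.Tendsto.const_mul (hσ.tendsto_tailWeight (fun _ => prob_le_one) hP)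
        (Or.inr ENNReal.coe_ne_top)
    refine tendsto_of_tendsto_of_tendsto_of_le_of_le tendsto_const_nhds h (fun _ => zero_le)
      fun s => ?_
    have hs := hφ.map_indicator_union hσ (hF s) (hU.diff (hF s)) disjoint_sdiff_right
    rw [union_sdiff_cancel (iUnion₂_subset fun i _ => subset_iUnion f i),
      hφ.map_indicator_biUnion hσ hf hd] at hs
    simp only
    rw [edist_comm, edist_eq_enorm_sub, hs, add_sub_cancel_left]
    exact hφ.enorm_indicator_le hσ (hU.diff (hF s))

lemma IsBoundedFunctional.toVectorMeasure_apply (hσ : IsDistortion σ)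
    (hφ : IsBoundedFunctional P σ φ C) {A : Set Ω} (hA : MeasurableSet A) :
    hφ.toVectorMeasure hσ A = φ (A.indicator 1) :=
  if_pos hA

/-- Radon–Nikodym for a continuous real component of a `𝕂`-valued vector measure. -/
lemma exists_setIntegral_eq_of_absolutelyContinuous (v : VectorMeasure Ω 𝕂)
    (hv : ∀ A, MeasurableSet A → P A = 0 → v A = 0) {f : 𝕂 →+ ℝ} (hf : Continuous f) :
    ∃ g : Ω → ℝ, Integrable g P ∧ ∀ A, MeasurableSet A → f (v A) = ∫ ω in A, g ω ∂P := by
  set s : SignedMeasure Ω := v.mapRange f hf with hs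
  have hac : s ≪ᵥ P.toENNRealVectorMeasure := by
    refine VectorMeasure.AbsolutelyContinuous.mk fun A hA h0 => ?_
    rw [Measure.toENNRealVectorMeasure_apply_measurable hA] at h0
    rw [hs, VectorMeasure.mapRange_apply, hv A hA h0, map_zero]
  refine ⟨s.rnDeriv P, SignedMeasure.integrable_rnDeriv _ _, fun A hA => ?_⟩
  have h := congrArg (fun w : SignedMeasure Ω => w A)
    (SignedMeasure.withDensityᵥ_rnDeriv_eq s P hac)
  simp only [withDensityᵥ_apply (SignedMeasure.integrable_rnDeriv s P) hA] at h
  rw [h, hs, VectorMeasure.mapRange_apply]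

/-- The density of `A ↦ φ(1_A)`. -/
lemma IsBoundedFunctional.exists_density (hσ : IsDistortion σ)
    (hφ : IsBoundedFunctional P σ φ C) :
    ∃ Z : Ω → 𝕂, Integrable Z P ∧
      ∀ A, MeasurableSet A → φ (A.indicator 1) = ∫ ω in A, Z ω ∂P := by
  set v := hφ.toVectorMeasure hσ with hv
  have hac : ∀ A, MeasurableSet A → P A = 0 → v A = 0 := fun A hA h0 => by
    have := hφ.enorm_indicator_le hσ hA
    rw [h0, tailWeight_zero, mul_zero, nonpos_iff_eq_zero, enorm_eq_zero] at this
    rw [hv, hφ.toVectorMeasure_apply hσ hA, this]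
  obtain ⟨g₁, hg₁, h₁⟩ := exists_setIntegral_eq_of_absolutelyContinuous v hac
    (f := RCLike.re) RCLike.continuous_re
  obtain ⟨g₂, hg₂, h₂⟩ := exists_setIntegral_eq_of_absolutelyContinuous v hac
    (f := RCLike.im) RCLike.continuous_im
  refine ⟨fun ω => (g₁ ω : 𝕂) + (g₂ ω : 𝕂) * RCLike.I,
    hg₁.ofReal.add (hg₂.ofReal.mul_const _), fun A hA => ?_⟩
  rw [integral_add hg₁.ofReal.restrict (hg₂.ofReal.mul_const _).restrict, integral_mul_const,
    integral_ofReal, integral_ofReal, ← h₁ A hA, ← h₂ A hA, RCLike.re_add_im,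
    hφ.toVectorMeasure_apply hσ hA]

variable {Z : Ω → 𝕂}

lemma IsBoundedFunctional.apply_simpleFunc (hσ : IsDistortion σ)
    (hφ : IsBoundedFunctional P σ φ C) (hZ : Integrable Z P)
    (h : ∀ A, MeasurableSet A → φ (A.indicator 1) = ∫ ω in A, Z ω ∂P) (f : SimpleFunc Ω 𝕂) :
    φ f = ∫ ω, Z ω * f ω ∂P := by
  induction f using SimpleFunc.induction with
  | const c hA =>
    rename_i A
    have h1 : ⇑(SimpleFunc.piecewise A hA (SimpleFunc.const Ω c) (SimpleFunc.const Ω 0))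
        = c • A.indicator (1 : Ω → 𝕂) := by
      ext ω
      by_cases hω : ω ∈ A <;> simp [hω]
    have h2 : (fun ω => Z ω * (c • A.indicator (1 : Ω → 𝕂)) ω)
        = A.indicator fun ω => c * Z ω := by
      ext ω
      by_cases hω : ω ∈ A <;> simp [hω, mul_comm]
    rw [h1, hφ.map_smul _ _ (hσ.memLsigma_indicator hA), h A hA, h2, integral_indicator hA,
      integral_const_mul]
  | add hd hf hg =>
    rename_i f g
    have hint : ∀ f : SimpleFunc Ω 𝕂, Integrable (fun ω => Z ω * f ω) P := fun f => by
      obtain ⟨c, hc⟩ := f.exists_forall_norm_le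
      exact hZ.mul_bdd f.aestronglyMeasurable (Eventually.of_forall hc)
    rw [SimpleFunc.coe_add, hφ.map_add _ _ (hσ.memLsigma_simpleFunc f)
      (hσ.memLsigma_simpleFunc g), hf, hg, ← integral_add (hint f) (hint g)]
    exact integral_congr_ae (Eventually.of_forall fun ω => (mul_add _ _ _).symm)

/-- Simple functions are dense in `L_σ^1(P)`, with domination. -/
lemma IsDistortion.exists_simpleFunc_tendsto (hσ : IsDistortion σ)
    (hrich : ∃ V : Ω → ℝ, IsUniformRV P V) {Y : Ω → 𝕂} (hY : MemLsigma P σ 1 Y)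
    (hYm : StronglyMeasurable Y) :
    ∃ f : ℕ → SimpleFunc Ω 𝕂, (∀ n ω, ‖f n ω‖ ≤ ‖Y ω‖ + ‖Y ω‖) ∧
      (∀ ω, Tendsto (fun n => f n ω) atTop (𝓝 (Y ω))) ∧
      Tendsto (fun n => sigmaPow P σ 1 (⇑(f n) - Y)) atTop (𝓝 0) := by
  set f : ℕ → SimpleFunc Ω 𝕂 := SimpleFunc.approxOn Y hYm.measurable univ 0 (mem_univ _) with hf
  have hb : ∀ n ω, ‖f n ω‖ ≤ ‖Y ω‖ + ‖Y ω‖ := fun n ω =>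
    SimpleFunc.norm_approxOn_zero_le hYm.measurable (mem_univ _) ω n
  have ht : ∀ ω, Tendsto (fun n => f n ω) atTop (𝓝 (Y ω)) := fun ω =>
    SimpleFunc.tendsto_approxOn hYm.measurable (mem_univ _) (by simp)
  refine ⟨f, hb, ht, hσ.tendsto_sigmaPow_one_zero hrich (W := fun ω => ‖((3 : 𝕂) • Y) ω‖)
    (fun n => (f n).aestronglyMeasurable.sub hY.1) ?_ (fun n ω => ?_)
    (Eventually.of_forall fun ω => ?_)⟩
  · have := hY.const_smul (3 : 𝕂)
    exact ⟨this.1.norm, (sigmaPow_one_mono fun ω => by simp).trans_lt this.2⟩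
  · refine (norm_sub_le _ _).trans ?_
    have := hb n ω
    simp only [Pi.smul_apply, norm_smul, norm_mul, norm_norm, RCLike.norm_ofNat]
    linarith
  · simpa using (ht ω).sub_const (Y ω)

lemma IsBoundedFunctional.apply_eq_integral_of_stronglyMeasurable (hσ : IsDistortion σ)
    (hrich : ∃ V : Ω → ℝ, IsUniformRV P V) (hφ : IsBoundedFunctional P σ φ C)
    (hZ : Integrable Z P)
    (h : ∀ A, MeasurableSet A → φ (A.indicator 1) = ∫ ω in A, Z ω ∂P) {Y : Ω → 𝕂}
    (hY : MemLsigma P σ 1 Y) (hYm : StronglyMeasurable Y)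
    (hZY : Integrable (fun ω => Z ω * Y ω) P) : φ Y = ∫ ω, Z ω * Y ω ∂P := by
  obtain ⟨f, hb, ht, hlim⟩ := hσ.exists_simpleFunc_tendsto hrich hY hYm
  refine tendsto_nhds_unique
    (hφ.tendsto hσ (fun n => hσ.memLsigma_simpleFunc (f n)) hY hlim) ?_
  simp only [hφ.apply_simpleFunc hσ hZ h]
  refine tendsto_integral_of_dominated_convergence (fun ω => 2 * ‖Z ω * Y ω‖)
    (fun n => hZ.1.mul (f n).aestronglyMeasurable) (hZY.norm.const_mul 2)
    (fun n => Eventually.of_forall fun ω => ?_)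
    (Eventually.of_forall fun ω => (ht ω).const_mul (Z ω))
  rw [norm_mul, norm_mul]
  nlinarith [hb n ω, norm_nonneg (Z ω)]

lemma IsBoundedFunctional.apply_eq_integral (hσ : IsDistortion σ)
    (hrich : ∃ V : Ω → ℝ, IsUniformRV P V) (hφ : IsBoundedFunctional P σ φ C)
    (hZ : Integrable Z P)
    (h : ∀ A, MeasurableSet A → φ (A.indicator 1) = ∫ ω in A, Z ω ∂P) {Y : Ω → 𝕂}
    (hY : MemLsigma P σ 1 Y) (hZY : Integrable (fun ω => Z ω * Y ω) P) :
    φ Y = ∫ ω, Z ω * Y ω ∂P := by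
  have hae := hY.1.ae_eq_mk
  have hmul : (fun ω => Z ω * Y ω) =ᵐ[P] fun ω => Z ω * hY.1.mk Y ω :=
    hae.mono fun ω hω => congrArg (Z ω * ·) hω
  rw [hφ.map_ae _ _ hY hae, integral_congr_ae hmul]
  exact hφ.apply_eq_integral_of_stronglyMeasurable hσ hrich hZ h (hY.congr_ae hae)
    hY.1.stronglyMeasurable_mk
    (hZY.congr hmul)

lemma IsBoundedFunctional.dualNormInf_le (hσ : IsDistortion σ)
    (hrich : ∃ V : Ω → ℝ, IsUniformRV P V) (hφ : IsBoundedFunctional P σ φ C)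
    (hZ : Integrable Z P)
    (h : ∀ A, MeasurableSet A → φ (A.indicator 1) = ∫ ω in A, Z ω ∂P) :
    dualNormInf P σ Z ≤ C := by
  refine hσ.dualNormInf_le_of_signTest hrich hZ fun A hA _ => ?_
  have hm := aestronglyMeasurable_signTest hZ.1 hA
  have hmem : MemLsigma P σ 1 (signTest Z A) :=
    hσ.memLsigma_of_norm_le hm (norm_signTest_le Z A)
  rw [← hφ.apply_eq_integral hσ hrich hZ h hmem
    (hZ.mul_bdd hm (Eventually.of_forall (norm_signTest_le Z A))), ofReal_norm]
  refine (hφ.enorm_le _ hmem).trans ?_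
  gcongr
  exact hσ.sigmaPow_one_signTest_le Z hA

/-- Every bounded functional is given by its density. -/
lemma IsBoundedFunctional.exists_eq_integral (hσ : IsDistortion σ)
    (hrich : ∃ V : Ω → ℝ, IsUniformRV P V) (hφ : IsBoundedFunctional P σ φ C) :
    ∃ Z : Ω → 𝕂, AEStronglyMeasurable Z P ∧ dualNormInf P σ Z < ∞ ∧
      ∀ Y : Ω → 𝕂, MemLsigma P σ 1 Y → φ Y = ∫ ω, Z ω * Y ω ∂P := by
  obtain ⟨Z, hZ, h⟩ := hφ.exists_density hσ
  have hD := (hφ.dualNormInf_le hσ hrich hZ h).trans_lt ENNReal.coe_lt_top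
  exact ⟨Z, hZ.1, hD, fun Y hY =>
    hφ.apply_eq_integral hσ hrich hZ h hY (hσ.integrable_mul hrich hZ.1 hD hY)⟩

end Surjectivity

lemma IsDistortion.ae_eq_of_integral_mul_eq {P : Measure Ω} [IsProbabilityMeasure P] {σ : ℝ → ℝ}
    (hσ : IsDistortion σ) (hrich : ∃ V : Ω → ℝ, IsUniformRV P V) {Z₁ Z₂ : Ω → 𝕂}
    (h₁ : AEStronglyMeasurable Z₁ P) (h₂ : AEStronglyMeasurable Z₂ P)
    (hD₁ : dualNormInf P σ Z₁ < ∞) (hD₂ : dualNormInf P σ Z₂ < ∞)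
    (h : ∀ Y : Ω → 𝕂, MemLsigma P σ 1 Y → ∫ ω, Z₁ ω * Y ω ∂P = ∫ ω, Z₂ ω * Y ω ∂P) :
    Z₁ =ᵐ[P] Z₂ := by
  have hD : dualNormInf P σ (Z₁ - Z₂) < ∞ := by
    rw [sub_eq_add_neg]
    refine (hσ.dualNormInf_add_le hrich h₁ h₂.neg).trans_lt ?_
    rw [dualNormInf_neg]
    exact ENNReal.add_lt_top.2 ⟨hD₁, hD₂⟩
  rw [← sub_ae_eq_zero]
  refine hσ.ae_eq_zero_of_dualNormInf_eq_zero (h₁.sub h₂) ?_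
  rw [hσ.dualNormInf_eq_iSup hrich (h₁.sub h₂) hD]
  refine ENNReal.iSup_eq_zero.2 fun Y => ENNReal.iSup_eq_zero.2 fun hY => ?_
  simp only [Pi.sub_apply, sub_mul]
  rw [integral_sub (hσ.integrable_mul hrich h₁ hD₁ hY.1) (hσ.integrable_mul hrich h₂ hD₂ hY.1),
    h Y hY.1, sub_self, norm_zero, ENNReal.ofReal_zero]

end DualityProof

/-- `|·|*_{σ,∞}` is a norm on `L*_{σ,∞}(P)` turning it into a Banach
space, and `Φ(Z)(Y) := E(ZY)` is an isometric isomorphism from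
`(L*_{σ,∞}(P), |·|*_{σ,∞})` onto the continuous dual of `L_σ^1(P)`. -/
theorem statement14
    (P : Measure Ω) [IsProbabilityMeasure P]
    (hrich : ∃ U : Ω → ℝ, IsUniformRV P U)
    {𝕂 : Type*} [RCLike 𝕂]
    (σ : ℝ → ℝ) (hσ : IsDistortion σ) :
    -- `|·|*_{σ,∞}` is a norm on `L*_{σ,∞}(P)`
    (∀ Z₁ Z₂ : Ω → 𝕂, AEStronglyMeasurable Z₁ P → AEStronglyMeasurable Z₂ P →
      dualNormInf P σ (Z₁ + Z₂) ≤ dualNormInf P σ Z₁ + dualNormInf P σ Z₂) ∧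
    (∀ (c : 𝕂) (Z : Ω → 𝕂),
      dualNormInf P σ (c • Z) = (‖c‖₊ : ℝ≥0∞) * dualNormInf P σ Z) ∧
    (∀ Z : Ω → 𝕂, AEStronglyMeasurable Z P → dualNormInf P σ Z = 0 → Z =ᵐ[P] 0) ∧
    -- completeness of `(L*_{σ,∞}(P), |·|*_{σ,∞})`
    (∀ Zs : ℕ → Ω → 𝕂,
      (∀ n, AEStronglyMeasurable (Zs n) P ∧ dualNormInf P σ (Zs n) < ∞) →
      (∀ ε : ℝ≥0∞, 0 < ε → ∃ N : ℕ, ∀ m n : ℕ, N ≤ m → N ≤ n →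
        dualNormInf P σ (Zs m - Zs n) < ε) →
      ∃ Z : Ω → 𝕂, AEStronglyMeasurable Z P ∧ dualNormInf P σ Z < ∞ ∧
        Filter.Tendsto (fun n => dualNormInf P σ (Zs n - Z)) Filter.atTop (nhds 0)) ∧
    -- `Φ(Z)` is a continuous linear functional on `L_σ^1(P)` and `Φ` is isometric
    (∀ Z : Ω → 𝕂, AEStronglyMeasurable Z P → dualNormInf P σ Z < ∞ →
      (∀ Y : Ω → 𝕂, MemLsigma P σ 1 Y → Integrable (fun ω => Z ω * Y ω) P) ∧
      dualNormInf P σ Z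
        = ⨆ (Y : Ω → 𝕂) (_ : MemLsigma P σ 1 Y ∧ sigmaNorm P σ 1 Y ≤ 1),
            ENNReal.ofReal ‖∫ ω, Z ω * Y ω ∂P‖) ∧
    -- `Φ` is injective
    (∀ Z₁ Z₂ : Ω → 𝕂, AEStronglyMeasurable Z₁ P → AEStronglyMeasurable Z₂ P →
      dualNormInf P σ Z₁ < ∞ → dualNormInf P σ Z₂ < ∞ →
      (∀ Y : Ω → 𝕂, MemLsigma P σ 1 Y → ∫ ω, Z₁ ω * Y ω ∂P = ∫ ω, Z₂ ω * Y ω ∂P) →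
      Z₁ =ᵐ[P] Z₂) ∧
    -- `Φ` is surjective onto the continuous dual of `L_σ^1(P)`
    (∀ φ : (Ω → 𝕂) → 𝕂,
      (∀ Y₁ Y₂ : Ω → 𝕂, MemLsigma P σ 1 Y₁ → MemLsigma P σ 1 Y₂ →
        φ (Y₁ + Y₂) = φ Y₁ + φ Y₂) →
      (∀ (c : 𝕂) (Y : Ω → 𝕂), MemLsigma P σ 1 Y → φ (c • Y) = c * φ Y) →
      (∀ Y₁ Y₂ : Ω → 𝕂, MemLsigma P σ 1 Y₁ → Y₁ =ᵐ[P] Y₂ → φ Y₁ = φ Y₂) →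
      (∃ C : ℝ, ∀ Y : Ω → 𝕂, MemLsigma P σ 1 Y →
        ‖φ Y‖ ≤ C * (sigmaNorm P σ 1 Y).toReal) →
      ∃ Z : Ω → 𝕂, AEStronglyMeasurable Z P ∧ dualNormInf P σ Z < ∞ ∧
        ∀ Y : Ω → 𝕂, MemLsigma P σ 1 Y → φ Y = ∫ ω, Z ω * Y ω ∂P) := by
  refine ⟨fun Z₁ Z₂ h₁ h₂ => hσ.dualNormInf_add_le hrich h₁ h₂,
    fun c Z => dualNormInf_const_smul σ c Z,
    fun Z hZ h => hσ.ae_eq_zero_of_dualNormInf_eq_zero hZ h,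
    fun Zs hZs hcau => hσ.dualNormInf_complete hrich hZs hcau,
    fun Z hZ hD => ⟨fun Y hY => hσ.integrable_mul hrich hZ hD hY,
      hσ.dualNormInf_eq_iSup hrich hZ hD⟩,
    fun Z₁ Z₂ h₁ h₂ hD₁ hD₂ h => hσ.ae_eq_of_integral_mul_eq hrich h₁ h₂ hD₁ hD₂ h, ?_⟩
  rintro φ hadd hsmul hae ⟨C, hC⟩
  refine IsBoundedFunctional.exists_eq_integral (φ := φ) (C := C.toNNReal) hσ hrich
    ⟨hadd, hsmul, hae, fun Y hY => ?_⟩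
  rw [← ofReal_norm]
  refine (ENNReal.ofReal_le_ofReal (hC Y hY)).trans ?_
  rw [ENNReal.ofReal_mul' ENNReal.toReal_nonneg, sigmaNorm_one, ENNReal.ofReal_toReal hY.2.ne]
  exact le_rfl

end
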